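/- arXiv:2411.15485 — 4 statements merged into one kernel-verified Lean document; each statement's English description precedes it below -/
import Mathlib

section
/- For every x ≥ 0 one has b·W(x) + c·W′(x) + ∫₀^x W′(x−y)·ν̄̄(y) dy = 1, where ν̄̄(y) = ∫_y^∞ ν̄(u) du is the integrated tail of ν. -/
open MeasureTheory Real Set Filter Topology

noncomputable def tailNu (ν : Measure ℝ) (y : ℝ) : ℝ := (ν (Set.Ici y)).toReal

noncomputable def itailNu (ν : Measure ℝ) (x : ℝ) : ℝ := ∫ y in Set.Ioi x, tailNu ν y

noncomputable def phi (b c : ℝ) (ν : Measure ℝ) (l : ℝ) : ℝ :=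
  b * l + c * l ^ 2 + ∫ y in Set.Ioi (0 : ℝ), (Real.exp (-l * y) - 1 + l * y) ∂ν

noncomputable def EE (l x : ℝ) : ENNReal := ENNReal.ofReal (Real.exp (-l * x))

lemma EE_meas (l : ℝ) : Measurable (EE l) := by
  unfold EE; fun_prop

lemma EE_add (l x y : ℝ) : EE l (x + y) = EE l x * EE l y := by
  unfold EE
  rw [← ENNReal.ofReal_mul (Real.exp_pos _).le, ← Real.exp_add]
  congr 2; ring

lemma EE_ne_zero (l x : ℝ) : EE l x ≠ 0 := by
  unfold EE; simp [Real.exp_pos]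

lemma EE_ne_top (l x : ℝ) : EE l x ≠ ⊤ := by
  unfold EE; simp

lemma EE_Ioi (l a : ℝ) (hl : 0 < l) :
    ∫⁻ x in Set.Ioi a, EE l x = ENNReal.ofReal (1 / l) * EE l a := by
  unfold EE
  rw [← ofReal_integral_eq_lintegral_ofReal, integral_exp_mul_Ioi (by linarith),
    ← ENNReal.ofReal_mul (by positivity)]
  · congr 1; field_simp
  · exact integrableOn_exp_mul_Ioi (by linarith) a
  · exact ae_of_all _ fun x => (Real.exp_pos _).le

/-- value of the mgf -/
lemma mgf_aux (h : ℝ → ENNReal) (hm : Measurable h) (h0 : ∀ x < 0, h x = 0)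
    (hL : ∀ l : ℝ, 0 < l → ∫⁻ x, EE l x * h x = ENNReal.ofReal (1 / l)) (t : ℝ) :
    ProbabilityTheory.mgf id (volume.withDensity (fun x => EE 1 x * h x)) t =
      if t < 1 then 1 / (1 - t) else 0 := by
  have key : ∫⁻ x, ENNReal.ofReal (Real.exp (t * x)) ∂(volume.withDensity (fun x => EE 1 x * h x))
      = ∫⁻ x, EE (1 - t) x * h x := by
    have hmm : Measurable (fun x => EE 1 x * h x) := (EE_meas 1).mul hm
    rw [lintegral_withDensity_eq_lintegral_mul _ hmm (by fun_prop)]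
    refine lintegral_congr fun x => ?_
    have : EE (1 - t) x = EE 1 x * ENNReal.ofReal (Real.exp (t * x)) := by
      unfold EE
      rw [← ENNReal.ofReal_mul (Real.exp_pos _).le, ← Real.exp_add]
      congr 2; ring
    simp only [Pi.mul_apply]
    rw [this]; ring
  unfold ProbabilityTheory.mgf
  rw [integral_eq_lintegral_of_nonneg_ae (ae_of_all _ fun x => (Real.exp_pos _).le)
    (by simp only [id]; fun_prop)]
  simp only [id]
  rw [key]
  split_ifs with ht
  · rw [hL _ (by linarith), ENNReal.toReal_ofReal (by apply one_div_nonneg.2; linarith)]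
  · have : ∫⁻ x, EE (1 - t) x * h x = ⊤ := by
      refine ENNReal.eq_top_of_forall_nnreal_le fun r => ?_
      have h1 := hL (1 / (r + 1)) (by positivity)
      have h2 : ∫⁻ x, EE (1 / (r + 1)) x * h x ≤ ∫⁻ x, EE (1 - t) x * h x := by
        refine lintegral_mono fun x => ?_
        rcases lt_or_ge x 0 with hx | hx
        · simp [h0 x hx]
        · refine mul_le_mul_left ?_ _
          unfold EE
          refine ENNReal.ofReal_le_ofReal (Real.exp_le_exp.2 ?_)
          have : (0:ℝ) < 1 / (r + 1) := by positivity
          nlinarith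
      refine le_trans ?_ h2
      rw [h1]
      simp only [one_div_one_div]
      rw [← ENNReal.ofReal_coe_nnreal]
      exact ENNReal.ofReal_le_ofReal (by simp)
    rw [this]; simp

lemma laplace_unique (h : ℝ → ENNReal) (hm : Measurable h) (h0 : ∀ x < 0, h x = 0)
    (hL : ∀ l : ℝ, 0 < l → ∫⁻ x, EE l x * h x = ENNReal.ofReal (1 / l)) :
    h =ᵐ[volume] (Set.Ioi (0:ℝ)).indicator (fun _ => 1) := by
  set g : ℝ → ENNReal := (Set.Ioi (0:ℝ)).indicator (fun _ => 1) with hg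
  have gm : Measurable g := measurable_const.indicator measurableSet_Ioi
  have g0 : ∀ x < 0, g x = 0 := by
    intro x hx; rw [hg]; apply Set.indicator_of_notMem; simp [hx.le]
  have gL : ∀ l : ℝ, 0 < l → ∫⁻ x, EE l x * g x = ENNReal.ofReal (1 / l) := by
    intro l hl
    have : ∀ x, EE l x * g x = (Set.Ioi (0:ℝ)).indicator (EE l) x := by
      intro x; rw [hg]; by_cases hx : x ∈ Set.Ioi (0:ℝ) <;> simp [Set.indicator, hx]
    simp_rw [this]
    rw [lintegral_indicator measurableSet_Ioi, EE_Ioi l 0 hl]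
    simp [EE]
  set μ := volume.withDensity (fun x => EE 1 x * h x) with hμ
  set μ' := volume.withDensity (fun x => EE 1 x * g x) with hμ'
  have u : μ Set.univ = 1 := by
    rw [hμ, withDensity_apply _ MeasurableSet.univ]; simpa using hL 1 one_pos
  have u' : μ' Set.univ = 1 := by
    rw [hμ', withDensity_apply _ MeasurableSet.univ]; simpa using gL 1 one_pos
  have : IsProbabilityMeasure μ := ⟨u⟩
  have : IsProbabilityMeasure μ' := ⟨u'⟩
  have hmgf : ProbabilityTheory.mgf id μ = ProbabilityTheory.mgf id μ' := by
    ext t; rw [hμ, hμ', mgf_aux h hm h0 hL, mgf_aux g gm g0 gL]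
  have hE := ProbabilityTheory.eqOn_complexMGF_of_mgf hmgf
  have h0mem : (0:ℝ) ∈ interior (ProbabilityTheory.integrableExpSet id μ) := by
    rw [mem_interior]
    refine ⟨Set.Iio 1, ?_, isOpen_Iio, by simp⟩
    intro t ht
    have : ProbabilityTheory.mgf id μ t ≠ 0 := by
      rw [hμ, mgf_aux h hm h0 hL, if_pos (Set.mem_Iio.1 ht)]
      simp only [Set.mem_Iio] at ht
      have : 0 < 1 - t := by linarith
      positivity
    by_contra hn
    exact this (integral_undef hn)
  have heq : μ = μ' := by
    refine Measure.ext_of_charFun ?_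
    ext t
    rw [← ProbabilityTheory.complexMGF_id_mul_I, ← ProbabilityTheory.complexMGF_id_mul_I]
    apply hE
    simpa using h0mem
  have hmm : Measurable (fun x => EE 1 x * h x) := (EE_meas 1).mul hm
  have gmm : Measurable (fun x => EE 1 x * g x) := (EE_meas 1).mul gm
  rw [hμ, hμ', withDensity_eq_iff hmm.aemeasurable
    gmm.aemeasurable (by rw [hL 1 one_pos]; simp)] at heq
  filter_upwards [heq] with x hx
  exact (ENNReal.mul_right_inj (EE_ne_zero 1 x) (EE_ne_top 1 x)).1 hx

lemma laplace_conv (f g : ℝ → ENNReal) (hf : Measurable f) (hg : Measurable g) (l : ℝ) :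
    ∫⁻ x, EE l x * ∫⁻ y, f (x - y) * g y = (∫⁻ x, EE l x * f x) * ∫⁻ y, EE l y * g y := by
  have hE := EE_meas l
  calc ∫⁻ x, EE l x * ∫⁻ y, f (x - y) * g y
      = ∫⁻ x, ∫⁻ y, (EE l (x - y) * f (x - y)) * (EE l y * g y) := by
        refine lintegral_congr fun x => ?_
        rw [← lintegral_const_mul _ (by fun_prop)]
        refine lintegral_congr fun y => ?_
        have : EE l x = EE l (x - y) * EE l y := by rw [← EE_add]; simp
        rw [this]; ring
    _ = ∫⁻ y, ∫⁻ x, (EE l (x - y) * f (x - y)) * (EE l y * g y) := by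
        apply lintegral_lintegral_swap
        apply Measurable.aemeasurable
        unfold Function.uncurry
        fun_prop
    _ = ∫⁻ y, (∫⁻ x, EE l x * f x) * (EE l y * g y) := by
        refine lintegral_congr fun y => ?_
        rw [lintegral_mul_const _ (by fun_prop)]
        rw [lintegral_sub_right_eq_self (fun x => EE l x * f x) y]
    _ = _ := by
        rw [lintegral_const_mul _ (by fun_prop)]


noncomputable def gg (ν : Measure ℝ) (x : ℝ) : ENNReal := ∫⁻ z, ENNReal.ofReal (z - x) ∂ν

noncomputable def II (ν : Measure ℝ) (l : ℝ) : ENNReal :=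
  ∫⁻ y in Set.Ioi (0 : ℝ), ENNReal.ofReal (Real.exp (-l * y) - 1 + l * y) ∂ν

lemma ae_pos_nu {ν : Measure ℝ} (hν0 : ν (Set.Iic 0) = 0) : ∀ᵐ y ∂ν, 0 < y := by
  rw [ae_iff]; simpa [Set.Iic] using hν0

lemma restrict_nu {ν : Measure ℝ} (hν0 : ν (Set.Iic 0) = 0) : ν.restrict (Set.Ioi 0) = ν :=
  Measure.restrict_eq_self_of_ae_mem (ae_pos_nu hν0)

lemma sfinite_nu {ν : Measure ℝ} (hν0 : ν (Set.Iic 0) = 0)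
    (hνint : ∫⁻ y in Set.Ioi (0 : ℝ), ENNReal.ofReal (min y (y ^ 2)) ∂ν ≠ ⊤) : SFinite ν := by
  rw [restrict_nu hν0] at hνint
  have h := withDensity_inv_same (μ := ν) (f := fun y => ENNReal.ofReal (min y (y ^ 2)))
    (by fun_prop) (by
      filter_upwards [ae_pos_nu hν0] with y hy
      have : 0 < min y (y ^ 2) := by positivity
      simp [hy, hy.ne']) (by simp)
  have : IsFiniteMeasure (ν.withDensity (fun y => ENNReal.ofReal (min y (y ^ 2)))) :=
    isFiniteMeasure_withDensity hνint
  rw [← h]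
  infer_instance

lemma psi_nonneg (l y : ℝ) : 0 ≤ Real.exp (-l * y) - 1 + l * y := by
  have := Real.add_one_le_exp (-l * y); linarith

lemma psi_le (l y : ℝ) (hl : 0 < l) (hy : 0 < y) :
    Real.exp (-l * y) - 1 + l * y ≤ (l + l ^ 2) * min y (y ^ 2) := by
  have hu : 0 < l * y := by positivity
  have h1 : Real.exp (-l * y) ≤ 1 := Real.exp_le_one_iff.2 (by linarith)
  have h2 : Real.exp (-l * y) ≤ 1 / (1 + l * y) := by
    rw [neg_mul, Real.exp_neg, ← one_div]
    apply one_div_le_one_div_of_le (by positivity)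
    have := Real.add_one_le_exp (l * y); linarith
  have h3 : 1 / (1 + l * y) ≤ 1 - l * y + (l * y) ^ 2 := by
    rw [div_le_iff₀ (by positivity)]
    nlinarith [pow_pos hu 3]
  rcases min_cases y (y ^ 2) with ⟨h, _⟩ | ⟨h, _⟩ <;> rw [h]
  · nlinarith [mul_pos (pow_pos hl 2) hy]
  · nlinarith [mul_pos hl (pow_pos hy 2)]

lemma II_ne_top {ν : Measure ℝ}
    (hνint : ∫⁻ y in Set.Ioi (0 : ℝ), ENNReal.ofReal (min y (y ^ 2)) ∂ν ≠ ⊤) (l : ℝ) (hl : 0 < l) :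
    II ν l ≠ ⊤ := by
  have : II ν l ≤ ENNReal.ofReal (l + l ^ 2) *
      ∫⁻ y in Set.Ioi (0 : ℝ), ENNReal.ofReal (min y (y ^ 2)) ∂ν := by
    rw [← lintegral_const_mul _ (by fun_prop)]
    unfold II
    refine setLIntegral_mono (by fun_prop) fun y hy => ?_
    rw [← ENNReal.ofReal_mul (by positivity)]
    exact ENNReal.ofReal_le_ofReal (psi_le l y hl hy)
  exact ne_top_of_le_ne_top (ENNReal.mul_ne_top (by simp) hνint) this

lemma phi_eq (b c : ℝ) (ν : Measure ℝ) (l : ℝ) :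
    phi b c ν l = b * l + c * l ^ 2 + (II ν l).toReal := by
  unfold phi II
  rw [integral_eq_lintegral_of_nonneg_ae (ae_of_all _ fun y => psi_nonneg l y) (by fun_prop)]

lemma gg_ne_top {ν : Measure ℝ} (hν0 : ν (Set.Iic 0) = 0)
    (hνint : ∫⁻ y in Set.Ioi (0 : ℝ), ENNReal.ofReal (min y (y ^ 2)) ∂ν ≠ ⊤) (x : ℝ) (hx : 0 < x) :
    gg ν x ≠ ⊤ := by
  have : gg ν x ≤ ENNReal.ofReal (1 + 1 / x) *
      ∫⁻ y in Set.Ioi (0 : ℝ), ENNReal.ofReal (min y (y ^ 2)) ∂ν := by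
    rw [← lintegral_const_mul _ (by fun_prop)]
    unfold gg
    rw [restrict_nu hν0]
    refine lintegral_mono_ae ?_
    filter_upwards [ae_pos_nu hν0] with y hy
    rw [← ENNReal.ofReal_mul (by positivity)]
    apply ENNReal.ofReal_le_ofReal
    rcases le_total y x with h | h
    · have : 0 < min y (y ^ 2) := by positivity
      have : 0 < (1 + 1 / x) * min y (y ^ 2) := by positivity
      linarith
    · rcases min_cases y (y ^ 2) with ⟨h', _⟩ | ⟨h', _⟩ <;> rw [h']
      · have : 0 < 1 / x * y := by positivity
        nlinarith
      · have : y ≤ 1 / x * y ^ 2 := by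
          rw [one_div, inv_mul_eq_div, le_div_iff₀ hx]; nlinarith
        nlinarith [sq_nonneg y]
  exact ne_top_of_le_ne_top (ENNReal.mul_ne_top (by simp) hνint) this

lemma gg_anti (ν : Measure ℝ) : Antitone (gg ν) := by
  intro x y h
  exact lintegral_mono fun z => ENNReal.ofReal_le_ofReal (by linarith)

lemma tail_anti (ν : Measure ℝ) : Antitone (fun y => ν (Set.Ici y)) := by
  intro x y h
  exact measure_mono (Set.Ici_subset_Ici.2 h)

lemma gg_tail (ν : Measure ℝ) [SFinite ν] (x : ℝ) :
    ∫⁻ y in Set.Ioi x, ν (Set.Ici y) = gg ν x := by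
  have hmeas : MeasurableSet {p : ℝ × ℝ | p.1 ≤ p.2} :=
    measurableSet_le measurable_fst measurable_snd
  calc ∫⁻ y in Set.Ioi x, ν (Set.Ici y)
      = ∫⁻ y in Set.Ioi x, ∫⁻ z, {p : ℝ × ℝ | p.1 ≤ p.2}.indicator (fun _ => (1 : ENNReal)) (y, z) ∂ν := by
        refine lintegral_congr fun y => ?_
        rw [← lintegral_indicator_one measurableSet_Ici]
        refine lintegral_congr fun z => ?_
        simp [Set.indicator]
    _ = ∫⁻ z, (∫⁻ y in Set.Ioi x, {p : ℝ × ℝ | p.1 ≤ p.2}.indicator (fun _ => (1 : ENNReal)) (y, z)) ∂ν := by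
        apply lintegral_lintegral_swap
        exact (measurable_const.indicator hmeas).aemeasurable
    _ = gg ν x := by
        refine lintegral_congr fun z => ?_
        have : ∀ y, {p : ℝ × ℝ | p.1 ≤ p.2}.indicator (fun _ => (1 : ENNReal)) (y, z)
          = (Set.Iic z).indicator 1 y := by intro y; simp [Set.indicator]
        simp_rw [this]
        rw [lintegral_indicator_one measurableSet_Iic, Measure.restrict_apply measurableSet_Iic,
          Set.inter_comm, Set.Ioi_inter_Iic, Real.volume_Ioc]

lemma itail_eq {ν : Measure ℝ} (hν0 : ν (Set.Iic 0) = 0)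
    (hνint : ∫⁻ y in Set.Ioi (0 : ℝ), ENNReal.ofReal (min y (y ^ 2)) ∂ν ≠ ⊤) (x : ℝ) (hx : 0 < x) :
    itailNu ν x = (gg ν x).toReal := by
  have := sfinite_nu hν0 hνint
  have hm := (tail_anti ν).measurable
  unfold itailNu tailNu
  rw [integral_toReal hm.aemeasurable, gg_tail]
  apply ae_lt_top hm
  rw [gg_tail]
  exact gg_ne_top hν0 hνint x hx

lemma inner_eq (l z : ℝ) (hl : 0 < l) (hz : 0 < z) :
    ∫⁻ x in Set.Ioi (0 : ℝ), EE l x * ENNReal.ofReal (z - x) =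
      ENNReal.ofReal (1 / l ^ 2) * ENNReal.ofReal (Real.exp (-l * z) - 1 + l * z) := by
  have h1 : ∫⁻ x in Set.Ioi (0 : ℝ), EE l x * ENNReal.ofReal (z - x) =
      ∫⁻ x in Set.Ioc (0 : ℝ) z, ENNReal.ofReal (Real.exp (-l * x) * (z - x)) := by
    rw [← lintegral_indicator measurableSet_Ioi, ← lintegral_indicator measurableSet_Ioc]
    refine lintegral_congr fun x => ?_
    unfold EE
    by_cases hx : 0 < x
    · by_cases hxz : x ≤ z
      · simp [Set.indicator, hx, hxz, ENNReal.ofReal_mul (Real.exp_pos _).le]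
      · simp [Set.indicator, hx, hxz, ENNReal.ofReal_eq_zero]
        right; linarith
    · simp [Set.indicator, hx]
  have hc : Continuous (fun x : ℝ => Real.exp (-l * x) * (z - x)) := by fun_prop
  rw [h1, ← ofReal_integral_eq_lintegral_ofReal, ← intervalIntegral.integral_of_le hz.le,
    ← ENNReal.ofReal_mul (by positivity)]
  · congr 1
    have hd : ∀ x ∈ Set.uIcc 0 z, HasDerivAt
        (fun x : ℝ => Real.exp (-l * x) * ((x - z) / l + 1 / l ^ 2))
        (Real.exp (-l * x) * (z - x)) x := by
      intro x _
      have e1 : HasDerivAt (fun x : ℝ => Real.exp (-l * x)) (Real.exp (-l * x) * (-l * 1)) x :=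
        ((hasDerivAt_id x).const_mul (-l)).exp
      have e2 : HasDerivAt (fun x : ℝ => (x - z) / l + 1 / l ^ 2) (1 / l) x :=
        (((hasDerivAt_id x).sub_const z).div_const l).add_const _
      refine (e1.mul e2).congr_deriv ?_
      field_simp
      ring
    rw [intervalIntegral.integral_eq_sub_of_hasDerivAt hd (hc.intervalIntegrable _ _)]
    simp
    field_simp
    ring
  · exact hc.integrableOn_Ioc
  · filter_upwards [ae_restrict_mem measurableSet_Ioc] with x hx
    exact mul_nonneg (Real.exp_pos _).le (by linarith [hx.2])

lemma laplace_gg {ν : Measure ℝ} (hν0 : ν (Set.Iic 0) = 0) [SFinite ν] (l : ℝ) (hl : 0 < l) :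
    ∫⁻ x in Set.Ioi (0 : ℝ), EE l x * gg ν x = ENNReal.ofReal (1 / l ^ 2) * II ν l := by
  have hE := EE_meas l
  calc ∫⁻ x in Set.Ioi (0 : ℝ), EE l x * gg ν x
      = ∫⁻ x in Set.Ioi (0 : ℝ), ∫⁻ z, EE l x * ENNReal.ofReal (z - x) ∂ν := by
        refine lintegral_congr fun x => ?_
        rw [lintegral_const_mul _ (by fun_prop)]; rfl
    _ = ∫⁻ z, (∫⁻ x in Set.Ioi (0 : ℝ), EE l x * ENNReal.ofReal (z - x)) ∂ν := by
        apply lintegral_lintegral_swap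
        apply Measurable.aemeasurable
        unfold Function.uncurry
        fun_prop
    _ = ∫⁻ z, ENNReal.ofReal (1 / l ^ 2) * ENNReal.ofReal (Real.exp (-l * z) - 1 + l * z) ∂ν := by
        refine lintegral_congr_ae ?_
        filter_upwards [ae_pos_nu hν0] with z hz
        exact inner_eq l z hl hz
    _ = _ := by
        rw [lintegral_const_mul _ (by fun_prop)]
        unfold II
        rw [restrict_nu hν0]


noncomputable def HH : ℝ → ENNReal := (Set.Ioi (0:ℝ)).indicator (fun _ => 1)

lemma HH_meas : Measurable HH := measurable_const.indicator measurableSet_Ioi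

lemma laplace_HH (l : ℝ) (hl : 0 < l) : ∫⁻ x, EE l x * HH x = ENNReal.ofReal (1 / l) := by
  have : ∀ x, EE l x * HH x = (Set.Ioi (0:ℝ)).indicator (EE l) x := by
    intro x; unfold HH; by_cases hx : x ∈ Set.Ioi (0:ℝ) <;> simp [Set.indicator, hx]
  simp_rw [this]
  rw [lintegral_indicator measurableSet_Ioi, EE_Ioi l 0 hl]
  simp [EE]

lemma meas_of_cont {f : ℝ → ℝ} (hneg : ∀ x < 0, f x = 0) (hc : ContinuousOn f (Set.Ici 0)) :
    Measurable f := by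
  have h1 : Continuous (fun x => f (max x 0)) :=
    hc.comp_continuous (by fun_prop) (fun x => by simp)
  have : f = (Set.Ici (0:ℝ)).indicator (fun x => f (max x 0)) := by
    ext x
    by_cases hx : 0 ≤ x
    · simp [Set.indicator, hx]
    · simp [Set.indicator, hx, hneg x (not_le.1 hx)]
  rw [this]
  exact h1.measurable.indicator measurableSet_Ici

lemma W_zero (c : ℝ) (hc : 0 < c) (F : ℝ → ℝ) (W : ℝ → ℝ) (hWnonneg : ∀ x : ℝ, 0 ≤ W x)
    (hWmono : StrictMonoOn W (Set.Ici 0)) (hF : ∀ l : ℝ, 0 < l → c * l ^ 2 ≤ F l)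
    (hL : ∀ l : ℝ, 0 < l → ∫⁻ x in Set.Ioi (0:ℝ), EE l x * ENNReal.ofReal (W x)
      = ENNReal.ofReal (1 / F l)) : W 0 = 0 := by
  by_contra h
  have h0 : 0 < W 0 := lt_of_le_of_ne (hWnonneg 0) (Ne.symm h)
  have hb : ∀ l : ℝ, 0 < l → W 0 / l ≤ 1 / (c * l ^ 2) := by
    intro l hl
    have h1 : ∫⁻ x in Set.Ioi (0:ℝ), EE l x * ENNReal.ofReal (W 0) ≤
        ∫⁻ x in Set.Ioi (0:ℝ), EE l x * ENNReal.ofReal (W x) := by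
      refine setLIntegral_mono' measurableSet_Ioi fun x hx => ?_
      gcongr
      have hx' : (0:ℝ) < x := hx
      exact hWmono.monotoneOn (Set.mem_Ici.2 le_rfl) (Set.mem_Ici.2 hx'.le) hx'.le
    rw [lintegral_mul_const _ (EE_meas l), EE_Ioi l 0 hl, hL l hl] at h1
    have hp : 0 < c * l ^ 2 := by positivity
    have h2 : EE l 0 = 1 := by simp [EE]
    rw [h2, mul_one, ← ENNReal.ofReal_mul (by positivity),
      ENNReal.ofReal_le_ofReal_iff (one_div_nonneg.2 (hp.le.trans (hF l hl)))] at h1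
    have h3 := one_div_le_one_div_of_le hp (hF l hl)
    have : W 0 / l = 1 / l * W 0 := by ring
    linarith
  have := hb (2 / (c * W 0)) (by positivity)
  field_simp at this
  norm_num at this

lemma W_conv {W W' : ℝ → ℝ} (hW0 : W 0 = 0) (hWneg : ∀ x : ℝ, x < 0 → W x = 0)
    (hWcont : ContinuousOn W (Set.Ici 0))
    (hW'neg : ∀ x : ℝ, x < 0 → W' x = 0) (hW'nonneg : ∀ x, 0 ≤ W' x)
    (hW'deriv : ∀ x : ℝ, 0 < x → HasDerivAt W (W' x) x)
    (hW'cont : ContinuousOn W' (Set.Ici 0)) (x : ℝ) :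
    ENNReal.ofReal (W x) = ∫⁻ y, HH (x - y) * ENNReal.ofReal (W' y) := by
  have h1 : ∀ y, HH (x - y) * ENNReal.ofReal (W' y)
      = (Set.Ico 0 x).indicator (fun y => ENNReal.ofReal (W' y)) y := by
    intro y
    rcases lt_or_ge y 0 with hy | hy
    · simp [Set.indicator, hW'neg y hy]
    · by_cases hyx : y < x <;> simp [Set.indicator, HH, hy, hyx]
  simp_rw [h1]
  rw [lintegral_indicator measurableSet_Ico]
  rcases le_or_gt x 0 with hx | hx
  · rw [Set.Ico_eq_empty (by simpa using hx)]
    have : W x = 0 := by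
      rcases hx.lt_or_eq with h | h
      · exact hWneg x h
      · rw [h, hW0]
    simp [this]
  · have hii : IntervalIntegrable W' volume 0 x := by
      apply ContinuousOn.intervalIntegrable
      rw [Set.uIcc_of_le hx.le]
      exact hW'cont.mono Set.Icc_subset_Ici_self
    have := intervalIntegral.integral_eq_sub_of_hasDerivAt_of_le hx.le
      (hWcont.mono Set.Icc_subset_Ici_self) (fun y hy => hW'deriv y hy.1) hii
    rw [hW0, sub_zero] at this
    rw [setLIntegral_congr Ico_ae_eq_Ioc, ← this, intervalIntegral.integral_of_le hx.le,
      ofReal_integral_eq_lintegral_ofReal]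
    · exact (intervalIntegrable_iff_integrableOn_Ioc_of_le hx.le).1 hii
    · exact ae_of_all _ hW'nonneg

lemma conv_cont {ν : Measure ℝ} {W' : ℝ → ℝ}
    (hgg : ∀ R, ∫⁻ y in Set.Ioc 0 R, gg ν y ≠ ⊤)
    (hW'neg : ∀ x : ℝ, x < 0 → W' x = 0) (hW'nonneg : ∀ x, 0 ≤ W' x)
    (hW'cont : ContinuousOn W' (Set.Ici 0)) (x₀ : ℝ) (hx₀ : 0 < x₀) :
    ContinuousAt (fun x => ∫ y in Set.Ioi (0:ℝ), W' (x - y) * (gg ν y).toReal) x₀ := by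
  have hm := meas_of_cont hW'neg hW'cont
  have gm := (gg_anti ν).measurable
  obtain ⟨M, hM⟩ := (isCompact_Icc (a := (0:ℝ)) (b := x₀ + 1)).bddAbove_image
    (hW'cont.mono Set.Icc_subset_Ici_self)
  have hM' : ∀ u, u ≤ x₀ + 1 → W' u ≤ max M 0 := by
    intro u hu
    rcases lt_or_ge u 0 with h | h
    · rw [hW'neg u h]; exact le_max_right _ _
    · exact le_trans (hM ⟨u, ⟨h, hu⟩, rfl⟩) (le_max_left _ _)
  apply continuousAt_of_dominated
    (bound := (Set.Iic (x₀ + 1)).indicator fun y => max M 0 * (gg ν y).toReal)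
  · refine Eventually.of_forall fun x => ?_
    apply Measurable.aestronglyMeasurable
    fun_prop
  · filter_upwards [Iio_mem_nhds (show x₀ < x₀ + 1 by linarith)] with x hx
    filter_upwards [ae_restrict_mem measurableSet_Ioi] with y hy
    simp only [Set.mem_Iio, Set.mem_Ioi] at hx hy
    rw [Real.norm_of_nonneg (mul_nonneg (hW'nonneg _) ENNReal.toReal_nonneg)]
    by_cases h : y ≤ x₀ + 1
    · rw [Set.indicator_of_mem (by exact h)]
      gcongr
      exact hM' _ (by linarith)
    · rw [Set.indicator_of_notMem (by exact h), hW'neg _ (by linarith), zero_mul]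
  · rw [integrable_indicator_iff measurableSet_Iic, IntegrableOn,
      Measure.restrict_restrict measurableSet_Iic, Set.inter_comm, Set.Ioi_inter_Iic]
    exact (integrable_toReal_of_lintegral_ne_top gm.aemeasurable (hgg _)).const_mul _
  · have : ∀ᵐ y ∂(volume.restrict (Set.Ioi (0:ℝ))), y ≠ x₀ :=
      ae_restrict_of_ae (Measure.ae_ne volume x₀)
    filter_upwards [this] with y hy
    refine ContinuousAt.mul ?_ continuousAt_const
    have hc : ContinuousAt W' (x₀ - y) := by
      rcases lt_or_gt_of_ne hy with h | h
      · exact hW'cont.continuousAt (Ici_mem_nhds (by linarith))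
      · have : W' =ᶠ[𝓝 (x₀ - y)] fun _ => 0 := by
          filter_upwards [Iio_mem_nhds (show x₀ - y < 0 by linarith)] with u hu
          exact hW'neg u hu
        exact this.continuousAt
    exact ContinuousAt.comp (f := fun x => x - y) hc (by fun_prop)

/-- Lemma 2.1: for all `x ≥ 0`, `b·W(x) + c·W′(x) + (W′ * ν̄̄)(x) = 1`. -/
theorem stmt0
    (b c : ℝ) (hb : 0 ≤ b) (hc : 0 < c)
    (ν : Measure ℝ) (hν0 : ν (Set.Iic 0) = 0)
    (hνint : ∫⁻ y in Set.Ioi (0 : ℝ), ENNReal.ofReal (min y (y ^ 2)) ∂ν ≠ ⊤)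
    (W W' : ℝ → ℝ)
    (hWneg : ∀ x : ℝ, x < 0 → W x = 0)
    (hWnonneg : ∀ x : ℝ, 0 ≤ W x)
    (hWcont : ContinuousOn W (Set.Ici 0))
    (hWmono : StrictMonoOn W (Set.Ici 0))
    (hWlap : ∀ l : ℝ, 0 < l →
      (∫ x in Set.Ioi (0 : ℝ), Real.exp (-l * x) * W x) = 1 / phi b c ν l)
    (hW'neg : ∀ x : ℝ, x < 0 → W' x = 0)
    (hW'zero : W' 0 = 1 / c)
    (hW'deriv : ∀ x : ℝ, 0 < x → HasDerivAt W (W' x) x)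
    (hW'cont : ContinuousOn W' (Set.Ici 0))
    :
    ∀ x : ℝ, 0 ≤ x →
      b * W x + c * W' x + (∫ y in (0 : ℝ)..x, W' (x - y) * itailNu ν y) = 1 := by

  have hsf := sfinite_nu hν0 hνint
  have hW'nonneg : ∀ x, 0 ≤ W' x := by
    intro x
    rcases lt_trichotomy x 0 with h | h | h
    · rw [hW'neg x h]
    · rw [h, hW'zero]; positivity
    · by_contra hn
      push Not at hn
      have hd := hW'deriv x h
      have h1 : 0 ≤ derivWithin W (Set.Ici 0) x := hWmono.monotoneOn.derivWithin_nonneg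
      rw [derivWithin_of_mem_nhds (Ici_mem_nhds h), hd.deriv] at h1
      linarith
  have hphi : ∀ l : ℝ, 0 < l → c * l ^ 2 ≤ phi b c ν l := by
    intro l hl
    rw [phi_eq]
    have : 0 ≤ b * l := by positivity
    have := (II ν l).toReal_nonneg
    linarith
  have hphipos : ∀ l : ℝ, 0 < l → 0 < phi b c ν l := fun l hl =>
    lt_of_lt_of_le (by positivity) (hphi l hl)
  have wm := meas_of_cont hWneg hWcont
  have wm' := meas_of_cont hW'neg hW'cont
  have hLr : ∀ l : ℝ, 0 < l → ∫⁻ x in Set.Ioi (0:ℝ), EE l x * ENNReal.ofReal (W x)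
      = ENNReal.ofReal (1 / phi b c ν l) := by
    intro l hl
    rw [← hWlap l hl, ofReal_integral_eq_lintegral_ofReal]
    · refine lintegral_congr fun x => ?_
      rw [EE, ENNReal.ofReal_mul (Real.exp_pos _).le]
    · by_contra hn
      have h1 := hWlap l hl
      rw [integral_undef hn] at h1
      have := one_div_pos.2 (hphipos l hl)
      linarith
    · exact ae_of_all _ fun x => mul_nonneg (Real.exp_pos _).le (hWnonneg x)
  have hW0 : W 0 = 0 := W_zero c hc (phi b c ν) W hWnonneg hWmono hphi hLr
  have hLw : ∀ l : ℝ, 0 < l → ∫⁻ x, EE l x * ENNReal.ofReal (W x)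
      = ENNReal.ofReal (1 / phi b c ν l) := by
    intro l hl
    rw [← hLr l hl, ← lintegral_indicator measurableSet_Ioi]
    refine lintegral_congr fun x => ?_
    by_cases hx : 0 < x
    · simp [Set.indicator, hx]
    · have : W x = 0 := by
        rcases (not_lt.1 hx).lt_or_eq with h | h
        · exact hWneg x h
        · rw [h, hW0]
      simp [Set.indicator, this]
  have hLw' : ∀ l : ℝ, 0 < l → ∫⁻ x, EE l x * ENNReal.ofReal (W' x)
      = ENNReal.ofReal (l / phi b c ν l) := by
    intro l hl
    have h1 := hLw l hl
    have h2 := laplace_conv HH (fun y => ENNReal.ofReal (W' y)) HH_meas (by fun_prop) l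
    simp_rw [← W_conv hW0 hWneg hWcont hW'neg hW'nonneg hW'deriv hW'cont] at h2
    rw [h1, laplace_HH l hl] at h2
    have h3 : ENNReal.ofReal l * ENNReal.ofReal (1 / l) = 1 := by
      rw [← ENNReal.ofReal_mul hl.le, mul_one_div_cancel hl.ne', ENNReal.ofReal_one]
    rw [← one_mul (∫⁻ x, EE l x * ENNReal.ofReal (W' x)), ← h3, mul_assoc, ← h2,
      ← ENNReal.ofReal_mul hl.le]
    congr 1; ring
  set g0 : ℝ → ENNReal := (Set.Ioi (0:ℝ)).indicator (gg ν) with hg0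
  have gm := (gg_anti ν).measurable
  have g0m : Measurable g0 := gm.indicator measurableSet_Ioi
  have hLg : ∀ l : ℝ, 0 < l → ∫⁻ x, EE l x * g0 x = ENNReal.ofReal (1 / l ^ 2) * II ν l := by
    intro l hl
    rw [← laplace_gg hν0 l hl, ← lintegral_indicator measurableSet_Ioi]
    refine lintegral_congr fun x => ?_
    by_cases hx : 0 < x <;> simp [Set.indicator, hx, hg0]
  set cv : ℝ → ENNReal := fun x => ∫⁻ y, ENNReal.ofReal (W' (x - y)) * g0 y with hcv
  have cvm : Measurable cv := by
    apply Measurable.lintegral_prod_right'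
      (f := fun p : ℝ × ℝ => ENNReal.ofReal (W' (p.1 - p.2)) * g0 p.2)
    fun_prop
  have hcv0 : ∀ x < 0, cv x = 0 := by
    intro x hx
    rw [hcv]
    simp only
    rw [lintegral_eq_zero_iff (by fun_prop)]
    refine ae_of_all _ fun y => ?_
    by_cases hy : 0 < y
    · simp [hW'neg (x - y) (by linarith)]
    · simp [hg0, Set.indicator, hy]
  have hae := laplace_unique
    (fun x => ENNReal.ofReal b * ENNReal.ofReal (W x) + ENNReal.ofReal c * ENNReal.ofReal (W' x)
      + cv x) (by fun_prop)
    (fun x hx => by simp [hWneg x hx, hW'neg x hx, hcv0 x hx]) (by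
      intro l hl
      have hE := EE_meas l
      have hp := hphipos l hl
      have e1 : ∀ x, EE l x * (ENNReal.ofReal b * ENNReal.ofReal (W x)
          + ENNReal.ofReal c * ENNReal.ofReal (W' x) + cv x)
          = ENNReal.ofReal b * (EE l x * ENNReal.ofReal (W x))
          + ENNReal.ofReal c * (EE l x * ENNReal.ofReal (W' x)) + EE l x * cv x := by
        intro x; ring
      simp_rw [e1]
      rw [lintegral_add_left (by fun_prop), lintegral_add_left (by fun_prop),
        lintegral_const_mul _ (by fun_prop), lintegral_const_mul _ (by fun_prop),
        hLw l hl, hLw' l hl, hcv,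
        laplace_conv (fun y => ENNReal.ofReal (W' y)) g0 (by fun_prop) g0m l, hLw' l hl, hLg l hl,
        ← ENNReal.ofReal_toReal (II_ne_top hνint l hl)]
      have hI := (II ν l).toReal_nonneg
      rw [← ENNReal.ofReal_mul (by positivity), ← ENNReal.ofReal_mul (by positivity),
        ← ENNReal.ofReal_mul (by positivity), ← ENNReal.ofReal_mul (by positivity),
        ← ENNReal.ofReal_add (by positivity) (by positivity),
        ← ENNReal.ofReal_add (by positivity) (by positivity)]
      congr 1
      have hp' := phi_eq b c ν l
      have hl' := hl.ne'
      have hp0 := hp.ne'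
      field_simp
      rw [hp']
      ring)
  have hgg : ∀ R, ∫⁻ y in Set.Ioc 0 R, gg ν y ≠ ⊤ := by
    intro R
    have h1 : EE 1 R * ∫⁻ y in Set.Ioc 0 R, gg ν y ≤ ∫⁻ y in Set.Ioi (0:ℝ), EE 1 y * gg ν y := by
      rw [← lintegral_const_mul _ gm]
      refine le_trans (setLIntegral_mono' measurableSet_Ioc fun y hy => ?_)
        (lintegral_mono_set Set.Ioc_subset_Ioi_self)
      gcongr
      unfold EE
      exact ENNReal.ofReal_le_ofReal (Real.exp_le_exp.2 (by linarith [hy.2]))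
    have h2 : EE 1 R * ∫⁻ y in Set.Ioc 0 R, gg ν y ≠ ⊤ := by
      refine ne_top_of_le_ne_top ?_ h1
      rw [laplace_gg hν0 1 one_pos]
      exact ENNReal.mul_ne_top (by simp) (II_ne_top hνint 1 one_pos)
    intro h3
    rw [h3, ENNReal.mul_top (EE_ne_zero 1 R)] at h2
    exact h2 rfl
  set K : ℝ → ℝ := fun x => ∫ y in Set.Ioi (0:ℝ), W' (x - y) * (gg ν y).toReal with hK
  have hKcv : ∀ x, K x = (cv x).toReal := by
    intro x
    rw [hK, hcv]
    simp only
    rw [integral_eq_lintegral_of_nonneg_ae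
      (ae_of_all _ fun y => mul_nonneg (hW'nonneg _) ENNReal.toReal_nonneg)
      (by apply Measurable.aestronglyMeasurable; fun_prop), ← lintegral_indicator measurableSet_Ioi]
    congr 1
    refine lintegral_congr fun y => ?_
    by_cases hy : 0 < y
    · simp [Set.indicator, hy, hg0, ENNReal.ofReal_mul (hW'nonneg _),
        ENNReal.ofReal_toReal (gg_ne_top hν0 hνint y hy)]
    · simp [Set.indicator, hy, hg0]
  have hKint : ∀ x, 0 < x → (∫ y in (0 : ℝ)..x, W' (x - y) * itailNu ν y) = K x := by
    intro x hx
    rw [intervalIntegral.integral_of_le hx.le, hK, ← integral_indicator measurableSet_Ioc]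
    simp only
    rw [← integral_indicator measurableSet_Ioi]
    congr 1
    ext y
    by_cases hy : 0 < y
    · by_cases hyx : y ≤ x
      · simp [Set.indicator, hy, hyx, itail_eq hν0 hνint y hy]
      · simp [Set.indicator, hy, hyx, hW'neg (x - y) (by linarith)]
    · simp [Set.indicator, hy]
  have hae2 : (fun x => b * W x + c * W' x + K x) =ᵐ[volume.restrict (Set.Ioi (0:ℝ))]
      fun _ => (1:ℝ) := by
    rw [Filter.EventuallyEq, ae_restrict_iff' measurableSet_Ioi]
    filter_upwards [hae] with x hx hx0
    rw [Set.indicator_of_mem hx0] at hx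
    have hfin : cv x ≠ ⊤ := by
      intro h; rw [h] at hx; simp at hx
    have h1 := congrArg ENNReal.toReal hx
    rw [ENNReal.toReal_add (by finiteness) hfin,
      ENNReal.toReal_add (by finiteness) (by finiteness),
      ENNReal.toReal_mul, ENNReal.toReal_mul, ENNReal.toReal_ofReal hb, ENNReal.toReal_ofReal hc.le,
      ENNReal.toReal_ofReal (hWnonneg x), ENNReal.toReal_ofReal (hW'nonneg x), ← hKcv] at h1
    simpa using h1
  have hcont : ContinuousOn (fun x => b * W x + c * W' x + K x) (Set.Ioi 0) := by
    refine ContinuousOn.add (ContinuousOn.add ?_ ?_) ?_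
    · exact continuousOn_const.mul (hWcont.mono Set.Ioi_subset_Ici_self)
    · exact continuousOn_const.mul (hW'cont.mono Set.Ioi_subset_Ici_self)
    · intro x hx
      exact (conv_cont hgg hW'neg hW'nonneg hW'cont x hx).continuousWithinAt
  have hall := Measure.eqOn_open_of_ae_eq hae2 isOpen_Ioi hcont continuousOn_const
  intro x hx
  rcases hx.lt_or_eq with h | h
  · rw [hKint x h]; exact hall h
  · subst h
    simp [hW0, hW'zero, hc.ne']
end

section
/- For each T ≥ 0 there exists a constant C > 0 such that for every δ ∈ (0,1), ∫_{−∞}^T |W′(x+δ) − W′(x)|² dx ≤ C·δ (here W′ is extended by 0 on (−∞,0)). -/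
open MeasureTheory Real Set Filter Topology

lemma aux_sfinite (ν : Measure ℝ)
    (hνint : ∫⁻ y in Set.Ioi (0 : ℝ), ENNReal.ofReal (min y (y ^ 2)) ∂ν ≠ ⊤) :
    SFinite (ν.restrict (Set.Ioi 0)) := by
  have hfin : IsFiniteMeasure ((ν.restrict (Set.Ioi 0)).withDensity
      (fun y => ENNReal.ofReal (min y (y ^ 2)))) := isFiniteMeasure_withDensity hνint
  have hac : ν.restrict (Set.Ioi 0) ≪ (ν.restrict (Set.Ioi 0)).withDensity
      (fun y => ENNReal.ofReal (min y (y ^ 2))) := by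
    apply withDensity_absolutelyContinuous' (by fun_prop)
    filter_upwards [ae_restrict_mem measurableSet_Ioi] with y hy
    have : (0:ℝ) < y := hy
    have : 0 < min y (y^2) := by positivity
    exact (ENNReal.ofReal_pos.2 this).ne'
  exact sFinite_of_absolutelyContinuous hac

open ProbabilityTheory in
lemma aux_measure_unique {μ μ' : Measure ℝ} [IsFiniteMeasure μ] [IsFiniteMeasure μ']
    (h1 : ∀ t : ℝ, t < 1 → Integrable (fun x => Real.exp (t * x)) μ)
    (h2 : ∀ t : ℝ, t < 1 → Integrable (fun x => Real.exp (t * x)) μ')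
    (h : ∀ t : ℝ, t < 1 → ∫ x, Real.exp (t * x) ∂μ = ∫ x, Real.exp (t * x) ∂μ') : μ = μ' := by
  have hsub : ∀ m : Measure ℝ, (∀ t : ℝ, t < 1 → Integrable (fun x => Real.exp (t * x)) m) →
      AnalyticOnNhd ℂ (complexMGF id m) {z | z.re ∈ Set.Iio (1:ℝ)} := by
    intro m hm
    refine (analyticOnNhd_complexMGF (X := id) (μ := m)).mono ?_
    intro z hz
    exact interior_maximal (s := integrableExpSet id m) (fun t ht => hm t ht) isOpen_Iio hz
  have hE := AnalyticOnNhd.eqOn_of_preconnected_of_frequently_eq (hsub μ h1) (hsub μ' h2)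
    ((convex_Iio (𝕜 := ℝ) (1:ℝ)).linear_preimage Complex.reLm).isPreconnected
    (z₀ := ((0:ℝ) : ℂ)) (by simp) ?_
  · apply Measure.ext_of_charFun
    ext t
    rw [← complexMGF_id_mul_I, ← complexMGF_id_mul_I]
    apply hE
    simp
  · have h_real : ∃ᶠ (x : ℝ) in 𝓝[≠] 0, complexMGF id μ x = complexMGF id μ' x := by
      apply Filter.Eventually.frequently
      have : ∀ᶠ x : ℝ in 𝓝[≠] 0, x < 1 :=
        (eventually_lt_nhds (by norm_num : (0:ℝ) < 1)).filter_mono nhdsWithin_le_nhds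
      filter_upwards [this] with y hy
      rw [complexMGF_ofReal, complexMGF_ofReal]
      congr 1
      exact h y hy
    rw [frequently_iff_seq_forall] at h_real ⊢
    obtain ⟨xs, hx_tendsto, hx_eq⟩ := h_real
    refine ⟨fun n ↦ xs n, ?_, fun n ↦ ?_⟩
    · rw [tendsto_nhdsWithin_iff] at hx_tendsto ⊢
      constructor
      · exact (Complex.continuous_ofReal.tendsto 0).comp hx_tendsto.1
      · simpa using hx_tendsto.2
    · simp [hx_eq]

lemma aux_fun_unique {f g : ℝ → ℝ} (hf0 : ∀ x, 0 ≤ f x) (hg0 : ∀ x, 0 ≤ g x)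
    (hfi : ∀ l : ℝ, 0 < l → Integrable (fun x => Real.exp (-l * x) * f x))
    (hgi : ∀ l : ℝ, 0 < l → Integrable (fun x => Real.exp (-l * x) * g x))
    (h : ∀ l : ℝ, 0 < l → ∫ x, Real.exp (-l * x) * f x = ∫ x, Real.exp (-l * x) * g x) :
    f =ᵐ[volume] g := by
  have key : ∀ f : ℝ → ℝ, (∀ x, 0 ≤ f x) →
      (∀ l : ℝ, 0 < l → Integrable (fun x => Real.exp (-l * x) * f x)) →
      (AEMeasurable (fun x => ENNReal.ofReal (Real.exp (-1 * x) * f x)) ∧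
      IsFiniteMeasure (volume.withDensity fun x => ENNReal.ofReal (Real.exp (-1 * x) * f x)) ∧
      (∀ t : ℝ, t < 1 → Integrable (fun x => Real.exp (t * x))
        (volume.withDensity fun x => ENNReal.ofReal (Real.exp (-1 * x) * f x))) ∧
      (∀ t : ℝ, ∫ x, Real.exp (t * x)
        ∂(volume.withDensity fun x => ENNReal.ofReal (Real.exp (-1 * x) * f x))
        = ∫ x, Real.exp (-(1-t) * x) * f x)) := by
    intro f hf0 hfi
    have hm : AEMeasurable (fun x => ENNReal.ofReal (Real.exp (-1 * x) * f x)) :=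
      (hfi 1 one_pos).aestronglyMeasurable.aemeasurable.ennreal_ofReal
    have hpt : ∀ t x : ℝ, (ENNReal.ofReal (Real.exp (-1 * x) * f x)).toReal • Real.exp (t * x)
        = Real.exp (-(1-t) * x) * f x := by
      intro t x
      rw [ENNReal.toReal_ofReal (mul_nonneg (Real.exp_pos _).le (hf0 x)), smul_eq_mul,
        mul_right_comm, ← Real.exp_add]
      ring_nf
    refine ⟨hm, ?_, ?_, ?_⟩
    · exact isFiniteMeasure_withDensity_ofReal (hfi 1 one_pos).2
    · intro t ht
      rw [integrable_withDensity_iff_integrable_smul₀' hm (by simp)]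
      simp_rw [hpt]
      exact hfi _ (by linarith)
    · intro t
      rw [integral_withDensity_eq_integral_toReal_smul₀ hm (by simp)]
      simp_rw [hpt]
  obtain ⟨a1, a2, a3, a4⟩ := key f hf0 hfi
  obtain ⟨b1, b2, b3, b4⟩ := key g hg0 hgi
  have := aux_measure_unique a3 b3 (fun t ht => by rw [a4, b4]; exact h _ (by linarith))
  rw [withDensity_eq_iff_of_sigmaFinite a1 b1] at this
  filter_upwards [this] with x hx
  have e := Real.exp_pos (-1 * x)
  rw [ENNReal.ofReal_eq_ofReal_iff (mul_nonneg e.le (hf0 x)) (mul_nonneg e.le (hg0 x))] at hx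
  exact mul_left_cancel₀ e.ne' hx

noncomputable def auxK (b : ℝ) (ν : Measure ℝ) (x : ℝ) : ℝ :=
  (Set.Ioi (0:ℝ)).indicator (fun x => b + ∫ y in Set.Ioi (0 : ℝ), max (y - x) 0 ∂ν) x

lemma auxK_nonneg {b : ℝ} (hb : 0 ≤ b) (ν : Measure ℝ) (x : ℝ) : 0 ≤ auxK b ν x := by
  apply Set.indicator_nonneg
  intro x _
  have : 0 ≤ ∫ y in Set.Ioi (0 : ℝ), max (y - x) 0 ∂ν := integral_nonneg (fun y => le_max_right _ _)
  linarith

lemma aux_exp_bound {l y : ℝ} (hl : 0 < l) (hy : 0 < y) :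
    0 ≤ Real.exp (-l * y) - 1 + l * y ∧
    Real.exp (-l * y) - 1 + l * y ≤ (l + l ^ 2) * min y (y ^ 2) := by
  have hly : 0 < l * y := mul_pos hl hy
  have h0 := Real.add_one_le_exp (-l * y)
  refine ⟨by linarith, ?_⟩
  have h1 : Real.exp (-l * y) ≤ 1 := Real.exp_le_one_iff.2 (by nlinarith)
  have h2 : Real.exp (-l * y) - 1 + l * y ≤ l ^ 2 * y ^ 2 := by
    have h3 := Real.add_one_le_exp (l * y)
    have h4 : Real.exp (-l * y) * Real.exp (l * y) = 1 := by
      rw [← Real.exp_add]; simp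
    have h5 : Real.exp (-l * y) * (1 + l * y) ≤ 1 := by
      rw [← h4]; gcongr; linarith
    have h6 := Real.exp_pos (-l * y)
    nlinarith
  rcases min_cases y (y ^ 2) with h | h <;> rw [h.1]
  · nlinarith [sq_nonneg l]
  · nlinarith [sq_nonneg y, mul_pos hl (pow_pos hy 2)]

lemma aux_exp_integrable (ν : Measure ℝ)
    (hνint : ∫⁻ y in Set.Ioi (0 : ℝ), ENNReal.ofReal (min y (y ^ 2)) ∂ν ≠ ⊤) {l : ℝ} (hl : 0 < l) :
    IntegrableOn (fun y => Real.exp (-l * y) - 1 + l * y) (Set.Ioi 0) ν := by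
  have hi : IntegrableOn (fun y : ℝ => min y (y ^ 2)) (Set.Ioi 0) ν := by
    refine ⟨by fun_prop, ?_⟩
    rw [hasFiniteIntegral_iff_ofReal]
    · exact hνint.lt_top
    · filter_upwards [ae_restrict_mem measurableSet_Ioi] with y hy
      have : (0:ℝ) < y := hy
      have : 0 < min y (y^2) := by positivity
      exact this.le
  refine Integrable.mono' (hi.const_mul (l + l ^ 2)) (by fun_prop) ?_
  filter_upwards [ae_restrict_mem measurableSet_Ioi] with y hy
  have := aux_exp_bound hl hy
  rw [Real.norm_eq_abs, abs_of_nonneg this.1]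
  exact this.2

lemma aux_inner {l y : ℝ} (hl : 0 < l) (hy : 0 < y) :
    IntegrableOn (fun x => Real.exp (-l * x) * max (y - x) 0) (Set.Ioi 0) ∧
    ∫ x in Set.Ioi (0:ℝ), Real.exp (-l * x) * max (y - x) 0
      = (Real.exp (-l * y) - 1 + l * y) / l ^ 2 := by
  have hz : ∀ x ∈ Set.Ioi y, Real.exp (-l * x) * max (y - x) 0 = 0 := by
    intro x hx
    have : y < x := hx
    rw [max_eq_right (by linarith), mul_zero]
  have hI1 : IntegrableOn (fun x => Real.exp (-l * x) * max (y - x) 0) (Set.Ioc 0 y) :=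
    (Continuous.integrableOn_Icc (by fun_prop)).mono_set Set.Ioc_subset_Icc_self
  have hI2 : IntegrableOn (fun x => Real.exp (-l * x) * max (y - x) 0) (Set.Ioi y) := by
    rw [integrableOn_congr_fun hz measurableSet_Ioi]
    exact integrableOn_zero
  rw [← Set.Ioc_union_Ioi_eq_Ioi hy.le]
  refine ⟨hI1.union hI2, ?_⟩
  rw [setIntegral_union Set.Ioc_disjoint_Ioi_same measurableSet_Ioi hI1 hI2,
    setIntegral_congr_fun measurableSet_Ioi hz, integral_zero, add_zero,
    ← intervalIntegral.integral_of_le hy.le]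
  have hd : ∀ x ∈ Set.uIcc 0 y, HasDerivAt
      (fun x => Real.exp (-l * x) * (-(y - x) / l + 1 / l ^ 2))
      (Real.exp (-l * x) * max (y - x) 0) x := by
    intro x hx
    rw [Set.uIcc_of_le hy.le] at hx
    rw [max_eq_left (by linarith [hx.2])]
    have h1 : HasDerivAt (fun x => Real.exp (-l * x)) (Real.exp (-l * x) * (-l * 1)) x :=
      ((hasDerivAt_id x).const_mul (-l)).exp
    have h2 : HasDerivAt (fun x => (-(y - x) / l + 1 / l ^ 2)) (-(0 - 1) / l) x :=
      ((((hasDerivAt_const x y).sub (hasDerivAt_id x)).neg).div_const l).add_const _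
    have h3 : HasDerivAt (fun x => Real.exp (-l * x) * (-(y - x) / l + 1 / l ^ 2)) _ x := h1.mul h2
    refine h3.congr_deriv ?_
    field_simp
    ring
  rw [intervalIntegral.integral_eq_sub_of_hasDerivAt hd
    (Continuous.intervalIntegrable (by fun_prop) _ _)]
  simp
  field_simp
  ring

lemma auxK_laplace {b c : ℝ} (ν : Measure ℝ)
    (hνint : ∫⁻ y in Set.Ioi (0 : ℝ), ENNReal.ofReal (min y (y ^ 2)) ∂ν ≠ ⊤) {l : ℝ} (hl : 0 < l) :
    Integrable (fun x => Real.exp (-l * x) * auxK b ν x) ∧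
    l ^ 2 * (c + ∫ x, Real.exp (-l * x) * auxK b ν x) = phi b c ν l := by
  have := aux_sfinite ν hνint
  have hprod : Integrable (fun p : ℝ × ℝ => Real.exp (-l * p.1) * max (p.2 - p.1) 0)
      ((volume.restrict (Set.Ioi (0:ℝ))).prod (ν.restrict (Set.Ioi 0))) := by
    rw [integrable_prod_iff' (by fun_prop)]
    constructor
    · filter_upwards [ae_restrict_mem measurableSet_Ioi] with y hy
      exact (aux_inner hl hy).1
    · refine ((aux_exp_integrable ν hνint hl).div_const (l ^ 2)).congr ?_
      filter_upwards [ae_restrict_mem measurableSet_Ioi] with y hy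
      rw [← (aux_inner hl hy).2]
      refine integral_congr_ae (.of_forall fun x => ?_)
      simp only
      rw [Real.norm_of_nonneg (mul_nonneg (Real.exp_pos _).le (le_max_right _ _))]
  have hI := hprod.integral_prod_left
  have hS := integral_integral_swap (f := fun x y => Real.exp (-l * x) * max (y - x) 0) hprod
  simp only [integral_const_mul] at hI hS
  have hS2 : ∫ y in Set.Ioi (0:ℝ), ∫ x in Set.Ioi (0:ℝ), Real.exp (-l * x) * max (y - x) 0 ∂volume ∂ν
      = (∫ y in Set.Ioi (0 : ℝ), (Real.exp (-l * y) - 1 + l * y) ∂ν) / l ^ 2 := by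
    rw [← integral_div]
    refine setIntegral_congr_fun measurableSet_Ioi fun y hy => (aux_inner hl hy).2
  rw [hS2] at hS
  have hb1 : IntegrableOn (fun x => Real.exp (-l * x) * b) (Set.Ioi 0) :=
    (integrableOn_exp_mul_Ioi (by linarith) 0).mul_const b
  have hb2 : ∫ x in Set.Ioi (0:ℝ), Real.exp (-l * x) * b = b / l := by
    rw [integral_mul_const, integral_exp_mul_Ioi (by linarith)]
    simp
    field_simp
  have heq : (fun x => Real.exp (-l * x) * auxK b ν x) = (Set.Ioi (0:ℝ)).indicator
      (fun x => Real.exp (-l * x) * b +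
        Real.exp (-l * x) * ∫ y in Set.Ioi (0 : ℝ), max (y - x) 0 ∂ν) := by
    ext x
    simp only [auxK, Set.indicator_apply]
    split_ifs <;> ring
  rw [heq]
  refine ⟨(integrable_indicator_iff measurableSet_Ioi).2 (hb1.add hI), ?_⟩
  rw [integral_indicator measurableSet_Ioi, integral_add hb1 hI, hS, hb2, phi]
  field_simp
  ring

lemma auxK_small {b c : ℝ} (hb : 0 ≤ b) (hc : 0 < c) (ν : Measure ℝ)
    (hνint : ∫⁻ y in Set.Ioi (0 : ℝ), ENNReal.ofReal (min y (y ^ 2)) ∂ν ≠ ⊤) :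
    ∃ θ : ℝ, 0 < θ ∧ ∫ x, Real.exp (-θ * x) * auxK b ν x ≤ c / 2 := by
  have hT : Tendsto (fun θ : ℝ => ∫ x, Real.exp (-θ * x) * auxK b ν x) atTop
      (𝓝 (∫ x : ℝ, (0:ℝ))) := by
    refine tendsto_integral_filter_of_dominated_convergence
      (fun x => Real.exp (-1 * x) * auxK b ν x) ?_ ?_
      (auxK_laplace (c := c) ν hνint one_pos).1 ?_
    · filter_upwards [eventually_gt_atTop 0] with θ hθ
      exact (auxK_laplace (c := c) ν hνint hθ).1.aestronglyMeasurable
    · filter_upwards [eventually_gt_atTop 1] with θ hθ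
      refine .of_forall fun x => ?_
      rw [Real.norm_of_nonneg (mul_nonneg (Real.exp_pos _).le (auxK_nonneg hb ν x))]
      by_cases hx : 0 < x
      · have := auxK_nonneg hb ν x
        gcongr
      · simp [auxK, hx]
    · refine .of_forall fun x => ?_
      by_cases hx : 0 < x
      · have : Tendsto (fun θ : ℝ => Real.exp (-θ * x)) atTop (𝓝 0) := by
          apply Real.tendsto_exp_atBot.comp
          exact (tendsto_neg_atTop_atBot).atBot_mul_const hx
        simpa using this.mul_const (auxK b ν x)
      · simp [auxK, hx]
  rw [integral_zero] at hT
  obtain ⟨θ, h1, h2⟩ := ((hT.eventually (eventually_lt_nhds (by positivity : 0 < c / 2))).and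
    (eventually_gt_atTop 0)).exists
  exact ⟨θ, h2, h1.le⟩

lemma aux_conv0 {f g : ℝ → ℝ} (hf : Integrable f) (hg : Integrable g) :
    (∀ᵐ x : ℝ, Integrable (fun t => f t * g (x - t))) ∧
    Integrable (fun x => ∫ t, f t * g (x - t)) ∧
    ∫ x, ∫ t, f t * g (x - t) = (∫ x, f x) * ∫ x, g x := by
  refine ⟨?_, ?_, ?_⟩
  · exact hf.ae_convolution_exists (ContinuousLinearMap.mul ℝ ℝ) hg
  · exact hf.integrable_convolution (ContinuousLinearMap.mul ℝ ℝ) hg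
  · exact integral_convolution (ContinuousLinearMap.mul ℝ ℝ) hf hg

lemma aux_conv {K G : ℝ → ℝ} {l : ℝ} (hf : Integrable (fun x => Real.exp (-l * x) * K x))
    (hg : Integrable (fun x => Real.exp (-l * x) * G x)) :
    (∀ᵐ x : ℝ, Integrable (fun t => K t * G (x - t))) ∧
    Integrable (fun x => Real.exp (-l * x) * ∫ t, K t * G (x - t)) ∧
    ∫ x, Real.exp (-l * x) * ∫ t, K t * G (x - t)
      = (∫ x, Real.exp (-l * x) * K x) * ∫ x, Real.exp (-l * x) * G x := by
  obtain ⟨h1, h2, h3⟩ := aux_conv0 hf hg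
  have e : ∀ x t, Real.exp (-l * t) * K t * (Real.exp (-l * (x - t)) * G (x - t))
      = Real.exp (-l * x) * (K t * G (x - t)) := by
    intro x t
    have : Real.exp (-l * x) = Real.exp (-l * t) * Real.exp (-l * (x - t)) := by
      rw [← Real.exp_add]; ring_nf
    rw [this]; ring
  simp only [e, integral_const_mul] at h1 h2 h3
  refine ⟨?_, h2, h3⟩
  filter_upwards [h1] with x hx
  exact (integrable_const_mul_iff (IsUnit.mk0 _ (Real.exp_pos _).ne') _).1 hx

lemma aux_shift {G : ℝ → ℝ} {l : ℝ} (a : ℝ) (hg : Integrable (fun x => Real.exp (-l * x) * G x)) :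
    Integrable (fun x => Real.exp (-l * x) * G (x + a)) ∧
    ∫ x, Real.exp (-l * x) * G (x + a) = Real.exp (l * a) * ∫ x, Real.exp (-l * x) * G x := by
  have e : (fun x => Real.exp (-l * x) * G (x + a))
      = fun x => Real.exp (l * a) * (Real.exp (-l * (x + a)) * G (x + a)) := by
    ext x
    rw [← mul_assoc, ← Real.exp_add]
    ring_nf
  rw [e]
  refine ⟨(hg.comp_add_right a).const_mul _, ?_⟩
  rw [integral_const_mul, integral_add_right_eq_self (fun x => Real.exp (-l * x) * G x)]

lemma aux_restr {G : ℝ → ℝ} (l : ℝ) (hG : ∀ x < 0, G x = 0) :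
    (∫ x in Set.Ioi (0:ℝ), Real.exp (-l * x) * G x) = ∫ x, Real.exp (-l * x) * G x := by
  rw [← integral_Ici_eq_integral_Ioi]
  apply setIntegral_eq_integral_of_forall_compl_eq_zero
  intro x hx
  rw [hG x (by simpa using hx), mul_zero]

lemma aux_max {l : ℝ} (hl : 0 < l) :
    Integrable (fun x => Real.exp (-l * x) * max x 0) ∧
    ∫ x, Real.exp (-l * x) * max x 0 = 1 / l ^ 2 := by
  have h : ∫ x, Real.exp (-l * x) * max x 0 = 1 / l ^ 2 := by
    rw [← aux_restr l (fun x hx => max_eq_right hx.le)]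
    have := Real.integral_rpow_mul_exp_neg_mul_Ioi (a := 2) (r := l) (by norm_num) hl
    rw [show (2:ℝ) - 1 = 1 by norm_num] at this
    simp only [Real.rpow_one, Real.Gamma_two, Real.rpow_two, mul_one] at this
    rw [← one_div_pow, ← this]
    refine setIntegral_congr_fun measurableSet_Ioi fun x hx => ?_
    have : (0:ℝ) < x := hx
    simp only [max_eq_left this.le]
    rw [mul_comm, neg_mul]
  refine ⟨?_, h⟩
  by_contra hn
  rw [integral_undef hn] at h
  have : 0 < 1 / l ^ 2 := by positivity
  linarith

lemma aux_dd {G : ℝ → ℝ} {l : ℝ} (δ ε : ℝ) (hg : Integrable (fun x => Real.exp (-l * x) * G x)) :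
    Integrable (fun x => Real.exp (-l * x) * (G (x + δ + ε) - G (x + δ) - G (x + ε) + G x)) ∧
    ∫ x, Real.exp (-l * x) * (G (x + δ + ε) - G (x + δ) - G (x + ε) + G x)
      = (Real.exp (l * δ) - 1) * (Real.exp (l * ε) - 1) * ∫ x, Real.exp (-l * x) * G x := by
  have h1 := aux_shift (δ + ε) hg
  simp only [← add_assoc] at h1
  have h2 := aux_shift δ hg
  have h3 := aux_shift ε hg
  have hi2 := h1.1.sub h2.1
  have hi3 := hi2.sub h3.1
  have hi4 := hi3.add hg
  have e : (fun x => Real.exp (-l * x) * (G (x + δ + ε) - G (x + δ) - G (x + ε) + G x))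
    = fun x => Real.exp (-l * x) * G (x + δ + ε) - Real.exp (-l * x) * G (x + δ)
      - Real.exp (-l * x) * G (x + ε) + Real.exp (-l * x) * G x := by
    ext x; ring
  rw [e]
  refine ⟨hi4, ?_⟩
  rw [integral_add (by exact hi3) hg, integral_sub (by exact hi2) h3.1, integral_sub h1.1 h2.1,
    h1.2, h2.2, h3.2, mul_add, Real.exp_add]
  ring

lemma aux_main_eq
    (b c : ℝ) (hb : 0 ≤ b) (hc : 0 < c) (ν : Measure ℝ)
    (hνint : ∫⁻ y in Set.Ioi (0 : ℝ), ENNReal.ofReal (min y (y ^ 2)) ∂ν ≠ ⊤)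
    (W : ℝ → ℝ)
    (hWneg : ∀ x : ℝ, x < 0 → W x = 0)
    (hWnonneg : ∀ x : ℝ, 0 ≤ W x)
    (hWlap : ∀ l : ℝ, 0 < l →
      (∫ x in Set.Ioi (0 : ℝ), Real.exp (-l * x) * W x) = 1 / phi b c ν l) :
    (∀ l : ℝ, 0 < l → Integrable (fun x => Real.exp (-l * x) * W x)) ∧
    (fun x => c * W x + ∫ t, auxK b ν t * W (x - t)) =ᵐ[volume] fun x => max x 0 := by
  have hK := fun l (hl : 0 < l) => auxK_laplace (b := b) (c := c) ν hνint hl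
  have hK0 : ∀ l : ℝ, 0 ≤ ∫ x, Real.exp (-l * x) * auxK b ν x := fun l =>
    integral_nonneg fun x => mul_nonneg (Real.exp_pos _).le (auxK_nonneg hb ν x)
  have hlap : ∀ l : ℝ, 0 < l → ∫ x, Real.exp (-l * x) * W x
      = 1 / (l ^ 2 * (c + ∫ x, Real.exp (-l * x) * auxK b ν x)) := by
    intro l hl
    rw [← aux_restr l hWneg, hWlap l hl, (hK l hl).2]
  have hWi : ∀ l : ℝ, 0 < l → Integrable (fun x => Real.exp (-l * x) * W x) := by
    intro l hl
    by_contra hn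
    have h := hlap l hl
    rw [integral_undef hn] at h
    have h0 := hK0 l
    have : 0 < 1 / (l ^ 2 * (c + ∫ x, Real.exp (-l * x) * auxK b ν x)) := by positivity
    linarith
  refine ⟨hWi, ?_⟩
  have hs : ∀ l : ℝ, (fun x => Real.exp (-l * x) * (c * W x + ∫ t, auxK b ν t * W (x - t)))
      = fun x => c * (Real.exp (-l * x) * W x)
        + Real.exp (-l * x) * ∫ t, auxK b ν t * W (x - t) := by
    intro l; ext x; ring
  refine aux_fun_unique ?_ (fun x => le_max_right _ _) ?_ (fun l hl => (aux_max hl).1) ?_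
  · intro x
    have : 0 ≤ ∫ t, auxK b ν t * W (x - t) :=
      integral_nonneg fun t => mul_nonneg (auxK_nonneg hb ν t) (hWnonneg _)
    have := hWnonneg x
    positivity
  · intro l hl
    rw [hs]
    exact ((hWi l hl).const_mul c).add (aux_conv (hK l hl).1 (hWi l hl)).2.1
  · intro l hl
    rw [hs, integral_add ((hWi l hl).const_mul c) (aux_conv (hK l hl).1 (hWi l hl)).2.1,
      (aux_conv (hK l hl).1 (hWi l hl)).2.2, integral_const_mul, (aux_max hl).2, ← add_mul,
      hlap l hl]
    have h0 := hK0 l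
    generalize (∫ x, Real.exp (-l * x) * auxK b ν x) = q at h0
    have : 0 < c + q := by positivity
    field_simp

lemma aux_exp_le (u : ℝ) : Real.exp u - 1 ≤ u * Real.exp u := by
  have h := Real.add_one_le_exp (-u)
  have h2 : Real.exp (-u) * Real.exp u = 1 := by rw [← Real.exp_add]; simp
  nlinarith [Real.exp_pos u]

lemma aux_P_nonneg {x δ ε : ℝ} (hδ : 0 < δ) (hε : 0 < ε) :
    0 ≤ max (x + δ + ε) 0 - max (x + δ) 0 - max (x + ε) 0 + max x 0 := by
  rcases max_cases (x + δ + ε) 0 with h | h <;> rcases max_cases (x + δ) 0 with h' | h' <;>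
  rcases max_cases (x + ε) 0 with h'' | h'' <;> rcases max_cases x 0 with h''' | h''' <;> linarith

lemma aux_F_bound
    (b c : ℝ) (hb : 0 ≤ b) (hc : 0 < c) (ν : Measure ℝ)
    (hνint : ∫⁻ y in Set.Ioi (0 : ℝ), ENNReal.ofReal (min y (y ^ 2)) ∂ν ≠ ⊤)
    (W : ℝ → ℝ)
    (hWi : ∀ l : ℝ, 0 < l → Integrable (fun x => Real.exp (-l * x) * W x))
    (hE : (fun x => c * W x + ∫ t, auxK b ν t * W (x - t)) =ᵐ[volume] fun x => max x 0)
    (θ : ℝ) (hθ : 0 < θ) (hsmall : ∫ x, Real.exp (-θ * x) * auxK b ν x ≤ c / 2)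
    (δ ε : ℝ) (hδ : 0 < δ) (hε : 0 < ε) :
    Integrable (fun x => Real.exp (-θ * x) * |W (x + δ + ε) - W (x + δ) - W (x + ε) + W x|) ∧
    ∫ x, Real.exp (-θ * x) * |W (x + δ + ε) - W (x + δ) - W (x + ε) + W x|
      ≤ 2 / c * (δ * ε * Real.exp (θ * (δ + ε))) := by
  set F : ℝ → ℝ := fun x => W (x + δ + ε) - W (x + δ) - W (x + ε) + W x with hF
  have hK := (auxK_laplace (b := b) (c := c) ν hνint hθ).1
  have hFi := (aux_dd δ ε (hWi θ hθ)).1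
  have hFa : Integrable (fun x => Real.exp (-θ * x) * |F x|) := by
    refine hFi.norm.congr (.of_forall fun x => ?_)
    simp only [norm_mul, Real.norm_eq_abs, Real.abs_exp]
    rfl
  refine ⟨hFa, ?_⟩
  have hP := aux_dd δ ε (aux_max hθ).1
  set P : ℝ → ℝ := fun x => max (x + δ + ε) 0 - max (x + δ) 0 - max (x + ε) 0 + max x 0 with hPdef
  have hC := aux_conv hK (hWi θ hθ)
  have hCF := aux_conv hK hFa
  have sh : ∀ (a : ℝ) {p : ℝ → Prop}, (∀ᵐ x : ℝ, p x) → ∀ᵐ x : ℝ, p (x + a) := fun a p h =>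
    (measurePreserving_add_right volume a).quasiMeasurePreserving.ae h
  have hpt : ∀ᵐ x : ℝ, c * |F x| ≤ P x + ∫ t, auxK b ν t * |F (x - t)| := by
    have hE' : ∀ᵐ x : ℝ, c * W x + ∫ t, auxK b ν t * W (x - t) = max x 0 := hE
    filter_upwards [hE', sh δ hE', sh ε hE', sh ε (sh δ hE'), hC.1, sh δ hC.1, sh ε hC.1,
      sh ε (sh δ hC.1)] with x e1 e2 e3 e4 i1 i2 i3 i4
    have r4 : x + ε + δ = x + δ + ε := by ring
    rw [r4] at e4 i4
    have hint : ∫ t, auxK b ν t * F (x - t) = (∫ t, auxK b ν t * W (x + δ + ε - t))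
        - (∫ t, auxK b ν t * W (x + δ - t)) - (∫ t, auxK b ν t * W (x + ε - t))
        + ∫ t, auxK b ν t * W (x - t) := by
      rw [← integral_sub i4 i2, ← integral_sub (by exact i4.sub i2) i3,
        ← integral_add (by exact (i4.sub i2).sub i3) i1]
      refine integral_congr_ae (.of_forall fun t => ?_)
      simp only [hF]
      rw [show x - t + δ + ε = x + δ + ε - t by ring, show x - t + δ = x + δ - t by ring,
        show x - t + ε = x + ε - t by ring]
      ring
    have hmain : c * F x = P x - ∫ t, auxK b ν t * F (x - t) := by
      rw [hint]
      simp only [hF, hPdef]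
      linarith
    have habs : |∫ t, auxK b ν t * F (x - t)| ≤ ∫ t, auxK b ν t * |F (x - t)| := by
      refine abs_integral_le_integral_abs.trans (le_of_eq ?_)
      refine integral_congr_ae (.of_forall fun t => ?_)
      simp only [abs_mul, abs_of_nonneg (auxK_nonneg hb ν t)]
    have hP0 : 0 ≤ P x := aux_P_nonneg hδ hε
    calc c * |F x| = |c * F x| := by rw [abs_mul, abs_of_pos hc]
      _ = |P x - ∫ t, auxK b ν t * F (x - t)| := by rw [hmain]
      _ ≤ |P x| + |∫ t, auxK b ν t * F (x - t)| := abs_sub _ _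
      _ ≤ _ := by rw [abs_of_nonneg hP0]; linarith
  set A := ∫ x, Real.exp (-θ * x) * |F x| with hA
  have hA0 : 0 ≤ A := integral_nonneg fun x => mul_nonneg (Real.exp_pos _).le (abs_nonneg _)
  have hineq : c * A ≤ (∫ x, Real.exp (-θ * x) * P x)
      + (∫ x, Real.exp (-θ * x) * auxK b ν x) * A := by
    rw [hA, ← hCF.2.2, ← integral_const_mul, ← integral_add hP.1 hCF.2.1]
    refine integral_mono_ae (hFa.const_mul c) (by exact hP.1.add hCF.2.1) ?_
    filter_upwards [hpt] with x hx
    have := mul_le_mul_of_nonneg_left hx (Real.exp_pos (-θ * x)).le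
    nlinarith
  have hPb : (∫ x, Real.exp (-θ * x) * P x) ≤ δ * ε * Real.exp (θ * (δ + ε)) := by
    rw [hP.2, (aux_max hθ).2]
    have h1 := aux_exp_le (θ * δ)
    have h2 := aux_exp_le (θ * ε)
    have h3 : 0 ≤ Real.exp (θ * ε) - 1 := by
      have := Real.add_one_le_exp (θ * ε); nlinarith [mul_pos hθ hε]
    calc _ ≤ (θ * δ * Real.exp (θ * δ)) * (θ * ε * Real.exp (θ * ε)) * (1 / θ ^ 2) := by gcongr
      _ = _ := by
        rw [mul_add, Real.exp_add]; field_simp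
  have : c / 2 * A ≤ δ * ε * Real.exp (θ * (δ + ε)) := by nlinarith
  calc A = 2 / c * (c / 2 * A) := by field_simp
    _ ≤ _ := by gcongr

/-- Corollary 2.3: L²-shift estimate for `W′` on `(−∞, T]`. -/
theorem stmt2
    (b c : ℝ) (hb : 0 ≤ b) (hc : 0 < c)
    (ν : Measure ℝ) (hν0 : ν (Set.Iic 0) = 0)
    (hνint : ∫⁻ y in Set.Ioi (0 : ℝ), ENNReal.ofReal (min y (y ^ 2)) ∂ν ≠ ⊤)
    (W W' : ℝ → ℝ)
    (hWneg : ∀ x : ℝ, x < 0 → W x = 0)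
    (hWnonneg : ∀ x : ℝ, 0 ≤ W x)
    (hWcont : ContinuousOn W (Set.Ici 0))
    (hWmono : StrictMonoOn W (Set.Ici 0))
    (hWlap : ∀ l : ℝ, 0 < l →
      (∫ x in Set.Ioi (0 : ℝ), Real.exp (-l * x) * W x) = 1 / phi b c ν l)
    (hW'neg : ∀ x : ℝ, x < 0 → W' x = 0)
    (hW'zero : W' 0 = 1 / c)
    (hW'deriv : ∀ x : ℝ, 0 < x → HasDerivAt W (W' x) x)
    (hW'cont : ContinuousOn W' (Set.Ici 0))
    :
    ∀ T : ℝ, 0 ≤ T → ∃ C : ℝ, 0 < C ∧ ∀ δ : ℝ, 0 < δ → δ < 1 →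
      (∫ x in Set.Iic T, |W' (x + δ) - W' x| ^ 2) ≤ C * δ := by
  intro T hT
  obtain ⟨hWi, hE⟩ := aux_main_eq b c hb hc ν hνint W hWneg hWnonneg hWlap
  obtain ⟨θ, hθ, hsmall⟩ := auxK_small hb hc ν hνint
  have hWm : Measurable W := by
    apply Monotone.measurable
    intro x y hxy
    rcases lt_or_ge x 0 with hx | hx
    · rw [hWneg x hx]; exact hWnonneg y
    · exact hWmono.monotoneOn hx (hx.trans hxy) hxy
  have hW'm : Measurable W' := by
    have : W' = (Set.Ici (0:ℝ)).indicator W' := by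
      ext x
      by_cases hx : x ∈ Set.Ici (0:ℝ)
      · rw [Set.indicator_of_mem hx]
      · rw [Set.indicator_of_notMem hx]; exact hW'neg x (by simpa using hx)
    rw [this]
    have h0 : (Set.Ici (0:ℝ)).indicator W' = (Set.Ici (0:ℝ)).piecewise W' (fun _ => 0) := by
      exact Set.piecewise_eq_indicator.symm
    rw [h0]
    exact hW'cont.measurable_piecewise continuousOn_const measurableSet_Ici
  have hder : ∀ x : ℝ, x ≠ 0 → HasDerivAt W (W' x) x := by
    intro x hx
    rcases lt_or_gt_of_ne hx with h | h
    · rw [hW'neg x h]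
      refine (hasDerivAt_const x (0:ℝ)).congr_of_eventuallyEq ?_
      filter_upwards [eventually_lt_nhds h] with y hy using hWneg y hy
    · exact hW'deriv x h
  have hFatou : ∀ δ : ℝ, 0 < δ → δ < 1 →
      ∫⁻ x, ENNReal.ofReal (Real.exp (-θ * x) * |W' (x + δ) - W' x|)
        ≤ ENNReal.ofReal (2 / c * (δ * Real.exp (θ * 2))) := by
    intro δ hδ hδ1
    set u : ℕ → ℝ := fun n => 1 / ((n:ℝ) + 1) with hu
    have hu0 : ∀ n, 0 < u n := fun n => by simp only [hu]; positivity
    have hu1 : ∀ n, u n ≤ 1 := fun n => by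
      simp only [hu]
      rw [div_le_one (by positivity)]
      have : (0:ℝ) ≤ n := n.cast_nonneg
      linarith
    have hut : Tendsto u atTop (𝓝[≠] 0) := by
      rw [tendsto_nhdsWithin_iff]
      exact ⟨tendsto_one_div_add_atTop_nhds_zero_nat, .of_forall fun n => (hu0 n).ne'⟩
    set G : ℕ → ℝ → ENNReal := fun n x => ENNReal.ofReal ((u n)⁻¹ *
      (Real.exp (-θ * x) * |W (x + δ + u n) - W (x + δ) - W (x + u n) + W x|)) with hG
    have hlim : ∀ᵐ x : ℝ, ENNReal.ofReal (Real.exp (-θ * x) * |W' (x + δ) - W' x|)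
        = liminf (fun n => G n x) atTop := by
      filter_upwards [compl_mem_ae_iff.2 (measure_singleton (0:ℝ)),
        compl_mem_ae_iff.2 (measure_singleton (-δ))] with x hx1 hx2
      have hx1' : x ≠ 0 := by simpa using hx1
      have hx2' : x + δ ≠ 0 := by
        intro h
        apply hx2
        simp only [Set.mem_singleton_iff]
        linarith
      have d1 := ((hasDerivAt_iff_tendsto_slope_zero.1 (hder x hx1')).comp hut)
      have d2 := ((hasDerivAt_iff_tendsto_slope_zero.1 (hder _ hx2')).comp hut)
      symm
      apply Tendsto.liminf_eq
      apply (ENNReal.continuous_ofReal.tendsto _).comp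
      refine (((d2.sub d1).abs).const_mul (Real.exp (-θ * x))).congr fun n => ?_
      simp only [Function.comp_apply, smul_eq_mul]
      rw [← mul_sub, abs_mul, abs_of_pos (inv_pos.2 (hu0 n)),
        show W (x + δ + u n) - W (x + δ) - (W (x + u n) - W x)
          = W (x + δ + u n) - W (x + δ) - W (x + u n) + W x by ring]
      ring
    rw [lintegral_congr_ae hlim]
    refine (lintegral_liminf_le (fun n => by simp only [hG]; fun_prop)).trans ?_
    refine liminf_le_of_frequently_le' (Frequently.of_forall fun n => ?_)
    obtain ⟨hi, hb'⟩ := aux_F_bound b c hb hc ν hνint W hWi hE θ hθ hsmall δ (u n) hδ (hu0 n)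
    simp only [hG]
    rw [← ofReal_integral_eq_lintegral_ofReal (hi.const_mul _)
      (.of_forall fun x => mul_nonneg (inv_pos.2 (hu0 n)).le
        (mul_nonneg (Real.exp_pos _).le (abs_nonneg _))), integral_const_mul]
    apply ENNReal.ofReal_le_ofReal
    have hun := hu0 n
    calc _ ≤ (u n)⁻¹ * (2 / c * (δ * u n * Real.exp (θ * (δ + u n)))) := by gcongr
      _ = 2 / c * (δ * Real.exp (θ * (δ + u n))) := by field_simp
      _ ≤ _ := by
        gcongr
        linarith [hu1 n]
  obtain ⟨M, hM⟩ := isCompact_Icc.exists_bound_of_continuousOn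
    (hW'cont.mono (fun x (hx : x ∈ Set.Icc 0 (T + 1)) => hx.1))
  have hM0 : 0 ≤ M := (norm_nonneg _).trans (hM 0 ⟨le_rfl, by linarith⟩)
  have hMb : ∀ x ≤ T + 1, |W' x| ≤ M := by
    intro x hx
    rcases lt_or_ge x 0 with h | h
    · rw [hW'neg x h, abs_zero]; exact hM0
    · exact hM x ⟨h, hx⟩
  refine ⟨(2 * M + 1) * Real.exp (θ * T) * (2 / c * Real.exp (θ * 2)), by positivity, ?_⟩
  intro δ hδ hδ1
  have hf := hFatou δ hδ hδ1
  have hnn : ∀ x, 0 ≤ Real.exp (-θ * x) * |W' (x + δ) - W' x| :=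
    fun x => mul_nonneg (Real.exp_pos _).le (abs_nonneg _)
  have hint : Integrable (fun x => Real.exp (-θ * x) * |W' (x + δ) - W' x|) := by
    refine ⟨Measurable.aestronglyMeasurable (by fun_prop), ?_⟩
    rw [hasFiniteIntegral_iff_ofReal (.of_forall hnn)]
    exact hf.trans_lt ENNReal.ofReal_lt_top
  have hle : ∫ x, Real.exp (-θ * x) * |W' (x + δ) - W' x| ≤ 2 / c * (δ * Real.exp (θ * 2)) := by
    rw [← ofReal_integral_eq_lintegral_ofReal hint (.of_forall hnn)] at hf
    exact (ENNReal.ofReal_le_ofReal_iff (by positivity)).1 hf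
  calc (∫ x in Set.Iic T, |W' (x + δ) - W' x| ^ 2)
      ≤ ∫ x in Set.Iic T, (2 * M + 1) * Real.exp (θ * T) *
          (Real.exp (-θ * x) * |W' (x + δ) - W' x|) := by
        refine integral_mono_of_nonneg (.of_forall fun x => sq_nonneg _)
          (hint.integrableOn.const_mul _) ?_
        filter_upwards [ae_restrict_mem measurableSet_Iic] with x hx
        have hx' : x ≤ T := hx
        have h1 : |W' (x + δ) - W' x| ≤ 2 * M + 1 := by
          have := abs_sub (W' (x + δ)) (W' x)
          have := hMb (x + δ) (by linarith)
          have := hMb x (by linarith)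
          linarith
        have h2 : 1 ≤ Real.exp (θ * T) * Real.exp (-θ * x) := by
          rw [← Real.exp_add]
          apply Real.one_le_exp
          nlinarith
        have h3 := abs_nonneg (W' (x + δ) - W' x)
        calc |W' (x + δ) - W' x| ^ 2 = |W' (x + δ) - W' x| * 1 * |W' (x + δ) - W' x| := by ring
          _ ≤ (2 * M + 1) * (Real.exp (θ * T) * Real.exp (-θ * x)) * |W' (x + δ) - W' x| := by
            gcongr
          _ = _ := by ring
    _ = (2 * M + 1) * Real.exp (θ * T) *
          ∫ x in Set.Iic T, (Real.exp (-θ * x) * |W' (x + δ) - W' x|) := integral_const_mul _ _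
    _ ≤ (2 * M + 1) * Real.exp (θ * T) * (2 / c * (δ * Real.exp (θ * 2))) := by
        gcongr
        exact (setIntegral_le_integral hint (.of_forall hnn)).trans hle
    _ = _ := by ring
end

section
/- For every β ≥ 0 and every x ≥ 0 one has W′(x) = W′_β(x) + (β − b)·(W′_β * W′)(x), where (W′_β * W′)(x) = ∫₀^x W′_β(x−y) W′(y) dy. -/
open MeasureTheory Real Set Filter Topology

lemma laplace_unique_s3 (D : ℝ → ℝ) (hD : Continuous D)
    (hint : ∀ l : ℝ, 0 < l → IntegrableOn (fun x => Real.exp (-l * x) * D x) (Set.Ioi 0))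
    (hz : ∀ l : ℝ, 0 < l → ∫ x in Set.Ioi (0 : ℝ), Real.exp (-l * x) * D x = 0) :
    ∀ x : ℝ, 0 ≤ x → D x = 0 := by
  set f : ℝ → ℝ := fun x => Real.exp (-x) * D x with hf
  have hfc : Continuous f := by fun_prop
  set P : Measure ℝ := volume.restrict (Set.Ioi 0) with hP
  have key : ∀ g : ℝ → ℝ, Continuous g →
      (∀ t : ℝ, t < 1 → Integrable (fun x => Real.exp (t * x) * g x) P) → ∀ t : ℝ, t < 1 →
      Integrable (fun x => Real.exp (t * x)) (P.withDensity (fun x => ENNReal.ofReal (g x))) ∧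
      ProbabilityTheory.mgf id (P.withDensity (fun x => ENNReal.ofReal (g x))) t
        = ∫ x, max (Real.exp (t * x) * g x) 0 ∂P := by
    intro g hg hgi t ht
    have e : ∀ x, max (Real.exp (t * x) * g x) 0 = Real.exp (t * x) * max (g x) 0 := by
      intro x
      rw [mul_max_of_nonneg _ _ (Real.exp_pos _).le, mul_zero]
    have hm : Measurable (fun x => ENNReal.ofReal (g x)) := hg.measurable.ennreal_ofReal
    constructor
    · rw [integrable_withDensity_iff hm (by simp)]
      simp only [ENNReal.toReal_ofReal']
      have := (hgi t ht).pos_part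
      simpa only [e] using this
    · rw [ProbabilityTheory.mgf, integral_withDensity_eq_integral_toReal_smul hm (by simp)]
      simp only [ENNReal.toReal_ofReal', id, smul_eq_mul, e]
      congr 1; ext x; ring
  have hfi : ∀ t : ℝ, t < 1 → Integrable (fun x => Real.exp (t * x) * f x) P := by
    intro t ht
    have := hint (1 - t) (by linarith)
    have e : (fun x => Real.exp (t * x) * f x) = fun x => Real.exp (-(1 - t) * x) * D x := by
      ext x
      rw [hf]; simp only; rw [← mul_assoc, ← Real.exp_add]; ring_nf
    rw [e]
    exact this
  have hf0 : ∀ t : ℝ, t < 1 → ∫ x, Real.exp (t * x) * f x ∂P = 0 := by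
    intro t ht
    rw [← hz (1 - t) (by linarith)]
    congr 1; ext x
    rw [hf]; simp only; rw [← mul_assoc, ← Real.exp_add]; ring_nf
  have hfi' : ∀ t : ℝ, t < 1 → Integrable (fun x => Real.exp (t * x) * (-f x)) P := by
    intro t ht
    simp only [mul_neg]
    exact (hfi t ht).neg
  have k1 := key f hfc hfi
  have k2 := key (fun x => -f x) hfc.neg hfi'
  set μ := P.withDensity (fun x => ENNReal.ofReal (f x)) with hμ
  set ν := P.withDensity (fun x => ENNReal.ofReal (-f x)) with hν
  have fin : ∀ m : Measure ℝ, Integrable (fun x => Real.exp (0 * x)) m → IsFiniteMeasure m := by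
    intro m h
    simpa [integrable_const_iff] using h
  have : IsFiniteMeasure μ := fin _ (k1 0 one_pos).1
  have : IsFiniteMeasure ν := fin _ (k2 0 one_pos).1
  have hmgf : ∀ t : ℝ, t < 1 → ProbabilityTheory.mgf id μ t = ProbabilityTheory.mgf id ν t := by
    intro t ht
    rw [(k1 t ht).2, (k2 t ht).2, ← sub_eq_zero, ← integral_sub (hfi t ht).pos_part
      (hfi' t ht).pos_part]
    refine Eq.trans ?_ (hf0 t ht)
    congr 1; ext x
    rcases le_total 0 (Real.exp (t * x) * f x) with h | h
    · rw [max_eq_left h, max_eq_right (by linarith), sub_zero]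
    · rw [max_eq_right h, max_eq_left (by linarith)]; ring
  have hs : ∀ m : Measure ℝ, (∀ t : ℝ, t < 1 → Integrable (fun x => Real.exp (t * x)) m) →
      ∀ t < 1, t ∈ interior (ProbabilityTheory.integrableExpSet id m) := by
    intro m h t ht
    rw [mem_interior]
    exact ⟨Set.Iio 1, fun s hs => h s hs, isOpen_Iio, ht⟩
  have hs1 := hs μ (fun t ht => (k1 t ht).1)
  have hs2 := hs ν (fun t ht => (k2 t ht).1)
  have hEq : Set.EqOn (ProbabilityTheory.complexMGF id μ) (ProbabilityTheory.complexMGF id ν)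
      {z : ℂ | z.re < 1} := by
    refine AnalyticOnNhd.eqOn_of_preconnected_of_frequently_eq (z₀ := ((0 : ℝ) : ℂ))
      (ProbabilityTheory.analyticOnNhd_complexMGF.mono fun z hz => hs1 _ hz)
      (ProbabilityTheory.analyticOnNhd_complexMGF.mono fun z hz => hs2 _ hz)
      ((convex_Iio (1 : ℝ)).linear_preimage Complex.reLm).isPreconnected (by simp) ?_
    have h1 : ∃ᶠ x : ℝ in 𝓝[≠] 0, ProbabilityTheory.complexMGF id μ x
        = ProbabilityTheory.complexMGF id ν x := by
      apply Filter.Eventually.frequently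
      have : ∀ᶠ x : ℝ in 𝓝[≠] 0, x < 1 := nhdsWithin_le_nhds (Iio_mem_nhds one_pos)
      filter_upwards [this] with x hx
      rw [ProbabilityTheory.complexMGF_ofReal, ProbabilityTheory.complexMGF_ofReal, hmgf x hx]
    refine Filter.Tendsto.frequently (f := fun x : ℝ => (x : ℂ)) ?_ h1
    refine tendsto_nhdsWithin_iff.2 ⟨?_, ?_⟩
    · exact (Complex.continuous_ofReal.tendsto 0).mono_left nhdsWithin_le_nhds
    · filter_upwards [self_mem_nhdsWithin] with x hx
      simpa using hx
  have hμν : μ = ν := by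
    apply Measure.ext_of_charFun
    ext t
    rw [← ProbabilityTheory.complexMGF_id_mul_I, ← ProbabilityTheory.complexMGF_id_mul_I]
    exact hEq (by simp)
  have hae := (withDensity_eq_iff_of_sigmaFinite (hfc.measurable.ennreal_ofReal.aemeasurable)
    (hfc.neg.measurable.ennreal_ofReal.aemeasurable)).1 hμν
  have hae2 : D =ᵐ[P] fun _ => (0 : ℝ) := by
    filter_upwards [hae] with x hx
    have h2 := congrArg ENNReal.toReal hx
    simp only [ENNReal.toReal_ofReal'] at h2
    have h3 : f x = 0 := by
      rcases le_total 0 (f x) with h | h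
      · rw [max_eq_left h, max_eq_right (by simpa using h)] at h2; exact h2
      · rw [max_eq_right h, max_eq_left (by simpa using h)] at h2; simpa using h2.symm
    exact (mul_eq_zero.1 h3).resolve_left (Real.exp_pos _).ne'
  have hE := Measure.eqOn_open_of_ae_eq hae2 isOpen_Ioi hD.continuousOn continuousOn_const
  have hE2 := hE.closure hD continuous_const
  rw [closure_Ioi] at hE2
  exact fun x hx => hE2 hx

lemma laplace_deriv (W W' : ℝ → ℝ) (c : ℝ) (hc : 0 < c)
    (hWnonneg : ∀ x : ℝ, 0 ≤ W x)
    (hWcont : ContinuousOn W (Set.Ici 0))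
    (hWmono : StrictMonoOn W (Set.Ici 0))
    (hpos : ∀ l : ℝ, 0 < l → 0 < ∫ x in Set.Ioi (0 : ℝ), Real.exp (-l * x) * W x)
    (hsmall : ∀ l : ℝ, 0 < l → ∫ x in Set.Ioi (0 : ℝ), Real.exp (-l * x) * W x ≤ 1 / (c * l ^ 2))
    (hW'deriv : ∀ x : ℝ, 0 < x → HasDerivAt W (W' x) x)
    (hW'cont : ContinuousOn W' (Set.Ici 0)) :
    (∀ x, 0 ≤ x → 0 ≤ W' x) ∧ ∀ l : ℝ, 0 < l →
      IntegrableOn (fun x => Real.exp (-l * x) * W' x) (Set.Ioi 0) ∧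
      ∫ x in Set.Ioi (0 : ℝ), Real.exp (-l * x) * W' x
        = l * ∫ x in Set.Ioi (0 : ℝ), Real.exp (-l * x) * W x := by
  have hint : ∀ l : ℝ, 0 < l → IntegrableOn (fun x => Real.exp (-l * x) * W x) (Set.Ioi 0) := by
    intro l hl
    by_contra h
    exact (hpos l hl).ne' (integral_undef h)
  have hexpint : ∀ l : ℝ, 0 < l → ∀ x, IntegrableOn (fun y => Real.exp (-l * y)) (Set.Ioi x) :=
    fun l hl x => integrableOn_exp_mul_Ioi (by linarith) x
  have hbd : ∀ l : ℝ, 0 < l → ∀ x, 0 ≤ x → W x * (Real.exp (-l * x) / l) ≤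
      ∫ y in Set.Ioi (0 : ℝ), Real.exp (-l * y) * W y := by
    intro l hl x hx
    have h1 : ∫ y in Set.Ioi x, Real.exp (-l * y) * W x = W x * (Real.exp (-l * x) / l) := by
      rw [integral_mul_const, integral_exp_mul_Ioi (by linarith)]
      field_simp
    rw [← h1]
    calc _ ≤ ∫ y in Set.Ioi x, Real.exp (-l * y) * W y := by
          apply setIntegral_mono_on ((hexpint l hl x).mul_const _)
            ((hint l hl).mono_set (Set.Ioi_subset_Ioi hx)) measurableSet_Ioi
          intro y hy
          have hy' : x < y := hy
          exact mul_le_mul_of_nonneg_left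
            (hWmono.monotoneOn (show (0:ℝ) ≤ x from hx) (show (0:ℝ) ≤ y by linarith) hy'.le)
            (Real.exp_pos _).le
      _ ≤ _ := by
          apply setIntegral_mono_set (hint l hl)
          · exact Filter.Eventually.of_forall fun y => mul_nonneg (Real.exp_pos _).le (hWnonneg y)
          · exact (Set.Ioi_subset_Ioi hx).eventuallyLE
  have hW0 : W 0 = 0 := by
    apply le_antisymm _ (hWnonneg 0)
    by_contra h
    push Not at h
    have hl : 0 < 2 / (c * W 0) := by positivity
    have h1 := (hbd _ hl 0 le_rfl).trans (hsmall _ hl)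
    have h2 : W 0 * (Real.exp (-(2 / (c * W 0)) * 0) / (2 / (c * W 0))) = c * W 0 ^ 2 / 2 := by
      simp; field_simp
    have h3 : 1 / (c * (2 / (c * W 0)) ^ 2) = c * W 0 ^ 2 / 4 := by field_simp; norm_num
    rw [h2, h3] at h1
    have : 0 < c * W 0 ^ 2 := by positivity
    linarith
  have hnn' : ∀ x, 0 < x → 0 ≤ W' x := by
    intro x hx
    have h1 : derivWithin W (Set.Ici 0) x = W' x := by
      rw [derivWithin_of_mem_nhds (Ici_mem_nhds hx)]; exact (hW'deriv x hx).deriv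
    rw [← h1]
    exact hWmono.monotoneOn.derivWithin_nonneg
  have hnn : ∀ x, 0 ≤ x → 0 ≤ W' x := by
    intro x hx
    have hcl : x ∈ closure (Set.Ioi (0:ℝ)) := by rw [closure_Ioi]; exact hx
    have hcw : ContinuousWithinAt W' (Set.Ioi 0) x := (hW'cont x hx).mono Set.Ioi_subset_Ici_self
    have := mem_closure_iff_nhdsWithin_neBot.1 hcl
    exact ge_of_tendsto hcw (by filter_upwards [self_mem_nhdsWithin] with y hy using hnn' y hy)
  refine ⟨hnn, fun l hl => ?_⟩
  have hcE : ContinuousOn (fun x => Real.exp (-l * x) * W x) (Set.Ici 0) :=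
    (by fun_prop : Continuous fun x : ℝ => Real.exp (-l * x)).continuousOn.mul hWcont
  have hlim0 : Tendsto (fun x => Real.exp (-l * x) * W x) atTop (𝓝 0) := by
    set C := ∫ y in Set.Ioi (0 : ℝ), Real.exp (-(l/2) * y) * W y with hC
    have hlim : Tendsto (fun x : ℝ => (l/2) * C * Real.exp (-(l/2) * x)) atTop (𝓝 0) := by
      have : Tendsto (fun x : ℝ => Real.exp (-(l/2) * x)) atTop (𝓝 0) := by
        apply Real.tendsto_exp_atBot.comp
        exact tendsto_id.const_mul_atTop_of_neg (by linarith)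
      simpa using this.const_mul ((l/2) * C)
    refine tendsto_of_tendsto_of_tendsto_of_le_of_le' tendsto_const_nhds hlim ?_ ?_
    · exact Filter.Eventually.of_forall fun y => mul_nonneg (Real.exp_pos _).le (hWnonneg y)
    · filter_upwards [eventually_ge_atTop 0] with x hx
      have h1 := hbd (l/2) (by linarith) x hx
      have h2 : Real.exp (-l * x) = Real.exp (-(l/2) * x) * Real.exp (-(l/2) * x) := by
        rw [← Real.exp_add]; ring_nf
      have h3 : W x * Real.exp (-(l/2) * x) ≤ (l/2) * C := by
        rw [mul_div_assoc', div_le_iff₀ (by linarith)] at h1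
        linarith
      rw [h2]
      nlinarith [Real.exp_pos (-(l/2) * x)]
  set g : ℝ → ℝ := fun x => Real.exp (-l * x) * W x
    + l * ∫ y in (0:ℝ)..x, Real.exp (-l * y) * W y with hg
  have hgint : ∀ x, 0 ≤ x → IntervalIntegrable (fun y => Real.exp (-l * y) * W y) volume 0 x := by
    intro x hx
    apply ContinuousOn.intervalIntegrable
    rw [Set.uIcc_of_le hx]
    exact hcE.mono Set.Icc_subset_Ici_self
  have hgl : Tendsto g atTop (𝓝 (l * ∫ x in Set.Ioi (0 : ℝ), Real.exp (-l * x) * W x)) := by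
    have := hlim0.add ((intervalIntegral_tendsto_integral_Ioi 0 (hint l hl) tendsto_id).const_mul l)
    rw [zero_add] at this
    exact this
  have hgd : ∀ x ∈ Set.Ioi (0:ℝ), HasDerivAt g (Real.exp (-l * x) * W' x) x := by
    intro x hx
    have hx' : 0 < x := hx
    have h1 : HasDerivAt (fun x => Real.exp (-l * x)) (Real.exp (-l * x) * (-l)) x := by
      simpa using ((hasDerivAt_id x).const_mul (-l)).exp
    have h2 := h1.mul (hW'deriv x hx)
    have h3 : HasDerivAt (fun x => ∫ y in (0:ℝ)..x, Real.exp (-l * y) * W y)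
        (Real.exp (-l * x) * W x) x := by
      apply intervalIntegral.integral_hasDerivAt_right (hgint x hx'.le)
      · exact (hcE.mono Set.Ioi_subset_Ici_self).stronglyMeasurableAtFilter isOpen_Ioi x hx
      · exact hcE.continuousAt (Ici_mem_nhds hx')
    have h4 := h2.add (h3.const_mul l)
    exact h4.congr_deriv (by ring)
  have hgc : ContinuousWithinAt g (Set.Ici 0) 0 := by
    apply ContinuousWithinAt.add (hcE 0 Set.self_mem_Ici)
    apply ContinuousWithinAt.const_mul
    have h1 : ContinuousOn (fun x => ∫ y in (0:ℝ)..x, Real.exp (-l * y) * W y) (Set.uIcc 0 1) :=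
      intervalIntegral.continuousOn_primitive_interval' (hgint 1 zero_le_one) (by simp)
    rw [Set.uIcc_of_le zero_le_one] at h1
    exact (h1 0 (by simp)).mono_of_mem_nhdsWithin (Icc_mem_nhdsGE one_pos)
  have hgp : ∀ x ∈ Set.Ioi (0:ℝ), 0 ≤ Real.exp (-l * x) * W' x :=
    fun x hx => mul_nonneg (Real.exp_pos _).le (hnn' x hx)
  refine ⟨integrableOn_Ioi_deriv_of_nonneg hgc hgd hgp hgl, ?_⟩
  rw [integral_Ioi_of_hasDerivAt_of_nonneg hgc hgd hgp hgl]
  simp [hg, hW0]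

lemma phi_int_nonneg (ν : Measure ℝ) (l : ℝ) :
    0 ≤ ∫ y in Set.Ioi (0 : ℝ), (Real.exp (-l * y) - 1 + l * y) ∂ν := by
  apply integral_nonneg
  intro y
  have := Real.add_one_le_exp (-l * y)
  simp only [Pi.zero_apply]
  linarith

/-- Lemma 2.4: resolvent identity `W′ = W′_β + (β − b)·(W′_β * W′)`. -/
theorem stmt3
    (b c : ℝ) (hb : 0 ≤ b) (hc : 0 < c)
    (ν : Measure ℝ) (hν0 : ν (Set.Iic 0) = 0)
    (hνint : ∫⁻ y in Set.Ioi (0 : ℝ), ENNReal.ofReal (min y (y ^ 2)) ∂ν ≠ ⊤)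
    (W W' : ℝ → ℝ)
    (hWneg : ∀ x : ℝ, x < 0 → W x = 0)
    (hWnonneg : ∀ x : ℝ, 0 ≤ W x)
    (hWcont : ContinuousOn W (Set.Ici 0))
    (hWmono : StrictMonoOn W (Set.Ici 0))
    (hWlap : ∀ l : ℝ, 0 < l →
      (∫ x in Set.Ioi (0 : ℝ), Real.exp (-l * x) * W x) = 1 / phi b c ν l)
    (hW'neg : ∀ x : ℝ, x < 0 → W' x = 0)
    (hW'zero : W' 0 = 1 / c)
    (hW'deriv : ∀ x : ℝ, 0 < x → HasDerivAt W (W' x) x)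
    (hW'cont : ContinuousOn W' (Set.Ici 0))
    (β : ℝ) (hβ : 0 ≤ β)
    (Wβ Wβ' : ℝ → ℝ)
    (hWβneg : ∀ x : ℝ, x < 0 → Wβ x = 0)
    (hWβnonneg : ∀ x : ℝ, 0 ≤ Wβ x)
    (hWβcont : ContinuousOn Wβ (Set.Ici 0))
    (hWβmono : StrictMonoOn Wβ (Set.Ici 0))
    (hWβlap : ∀ l : ℝ, 0 < l →
      (∫ x in Set.Ioi (0 : ℝ), Real.exp (-l * x) * Wβ x) = 1 / (phi b c ν l + (β - b) * l))
    (hWβ'neg : ∀ x : ℝ, x < 0 → Wβ' x = 0)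
    (hWβ'zero : Wβ' 0 = 1 / c)
    (hWβ'deriv : ∀ x : ℝ, 0 < x → HasDerivAt Wβ (Wβ' x) x)
    (hWβ'cont : ContinuousOn Wβ' (Set.Ici 0))
    :
    ∀ x : ℝ, 0 ≤ x →
      W' x = Wβ' x + (β - b) * ∫ y in (0 : ℝ)..x, Wβ' (x - y) * W' y := by
  have hφ : ∀ l : ℝ, 0 < l → c * l ^ 2 ≤ phi b c ν l := by
    intro l hl
    have := phi_int_nonneg ν l
    have : 0 ≤ b * l := by positivity
    unfold phi; linarith
  have hφβ : ∀ l : ℝ, 0 < l → c * l ^ 2 ≤ phi b c ν l + (β - b) * l := by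
    intro l hl
    have := phi_int_nonneg ν l
    have : 0 ≤ β * l := by positivity
    unfold phi; linarith
  have hcl : ∀ l : ℝ, 0 < l → 0 < c * l ^ 2 := fun l hl => by positivity
  obtain ⟨-, hA⟩ := laplace_deriv W W' c hc hWnonneg hWcont hWmono
    (fun l hl => by rw [hWlap l hl]; exact one_div_pos.2 ((hcl l hl).trans_le (hφ l hl)))
    (fun l hl => by rw [hWlap l hl]; exact one_div_le_one_div_of_le (hcl l hl) (hφ l hl))
    hW'deriv hW'cont
  obtain ⟨-, hB⟩ := laplace_deriv Wβ Wβ' c hc hWβnonneg hWβcont hWβmono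
    (fun l hl => by rw [hWβlap l hl]; exact one_div_pos.2 ((hcl l hl).trans_le (hφβ l hl)))
    (fun l hl => by rw [hWβlap l hl]; exact one_div_le_one_div_of_le (hcl l hl) (hφβ l hl))
    hWβ'deriv hWβ'cont
  set w : ℝ → ℝ := fun x => W' (max x 0) with hw
  set v : ℝ → ℝ := fun x => Wβ' (max x 0) with hv
  have hwc : Continuous w := hW'cont.comp_continuous (by fun_prop) (fun x => Set.mem_Ici.2 (le_max_right _ _))
  have hvc : Continuous v := hWβ'cont.comp_continuous (by fun_prop) (fun x => Set.mem_Ici.2 (le_max_right _ _))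
  have hw' : ∀ x, 0 ≤ x → w x = W' x := fun x hx => by simp [hw, hx]
  have hv' : ∀ x, 0 ≤ x → v x = Wβ' x := fun x hx => by simp [hv, hx]
  have hAi : ∀ l : ℝ, 0 < l → IntegrableOn (fun x => Real.exp (-l * x) * w x) (Set.Ioi 0) :=
    fun l hl => (hA l hl).1.congr_fun
      (fun x hx => by simp only [hw' x (le_of_lt hx)]) measurableSet_Ioi
  have hBi : ∀ l : ℝ, 0 < l → IntegrableOn (fun x => Real.exp (-l * x) * v x) (Set.Ioi 0) :=
    fun l hl => (hB l hl).1.congr_fun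
      (fun x hx => by simp only [hv' x (le_of_lt hx)]) measurableSet_Ioi
  have hAe : ∀ l : ℝ, 0 < l → ∫ x in Set.Ioi (0 : ℝ), Real.exp (-l * x) * w x
      = l * (1 / phi b c ν l) := fun l hl => by
    rw [← hWlap l hl, ← (hA l hl).2]
    exact setIntegral_congr_fun measurableSet_Ioi
      (fun x hx => by simp only [hw' x (le_of_lt hx)])
  have hBe : ∀ l : ℝ, 0 < l → ∫ x in Set.Ioi (0 : ℝ), Real.exp (-l * x) * v x
      = l * (1 / (phi b c ν l + (β - b) * l)) := fun l hl => by
    rw [← hWβlap l hl, ← (hB l hl).2]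
    exact setIntegral_congr_fun measurableSet_Ioi
      (fun x hx => by simp only [hv' x (le_of_lt hx)])
  set K : ℝ → ℝ := fun x => ∫ y in (0:ℝ)..x, v (x - y) * w y with hK
  have hKc : Continuous K := by
    apply intervalIntegral.continuous_parametric_intervalIntegral_of_continuous
      (f := fun x y => v (x - y) * w y) _ continuous_id
    simp only [Function.uncurry_def]
    fun_prop
  have hKl : ∀ l x : ℝ, ∫ t in (0:ℝ)..x, (ContinuousLinearMap.mul ℝ ℝ)
      (Real.exp (-l * t) * w t) (Real.exp (-l * (x - t)) * v (x - t))
      = Real.exp (-l * x) * K x := by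
    intro l x
    rw [hK, ← intervalIntegral.integral_const_mul]
    congr 1; ext t
    have : Real.exp (-l * x) = Real.exp (-l * t) * Real.exp (-l * (x - t)) := by
      rw [← Real.exp_add]; ring_nf
    rw [this, ContinuousLinearMap.mul_apply']; ring
  have hKi : ∀ l : ℝ, 0 < l → IntegrableOn (fun x => Real.exp (-l * x) * K x) (Set.Ioi 0) := by
    intro l hl
    have := integrable_posConvolution (hAi l hl) (hBi l hl) (ContinuousLinearMap.mul ℝ ℝ)
    rw [posConvolution, integrable_indicator_iff measurableSet_Ioi] at this
    simpa only [hKl] using this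
  have hKe : ∀ l : ℝ, 0 < l → ∫ x in Set.Ioi (0 : ℝ), Real.exp (-l * x) * K x
      = (l * (1 / phi b c ν l)) * (l * (1 / (phi b c ν l + (β - b) * l))) := by
    intro l hl
    have := integral_posConvolution (hAi l hl) (hBi l hl) (ContinuousLinearMap.mul ℝ ℝ)
    simp only [hKl, hAe l hl, hBe l hl] at this
    rw [this, ContinuousLinearMap.mul_apply']
  have hexp : ∀ l x : ℝ, Real.exp (-l * x) * (w x - v x - (β - b) * K x)
      = Real.exp (-l * x) * w x - Real.exp (-l * x) * v x
        - (β - b) * (Real.exp (-l * x) * K x) := fun l x => by ring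
  have hfin := laplace_unique_s3 (fun x => w x - v x - (β - b) * K x) (by fun_prop)
    (fun l hl => by
      simp only [hexp]
      exact ((hAi l hl).sub (hBi l hl)).sub ((hKi l hl).const_mul _))
    (fun l hl => by
      simp only [hexp]
      have i1 : Integrable (fun x => Real.exp (-l * x) * w x - Real.exp (-l * x) * v x)
        (volume.restrict (Set.Ioi 0)) := (hAi l hl).sub (hBi l hl)
      rw [integral_sub i1 ((hKi l hl).const_mul _),
        integral_sub (hAi l hl) (hBi l hl), integral_const_mul, hAe l hl, hBe l hl, hKe l hl]
      have p1 := (hcl l hl).trans_le (hφ l hl)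
      have p2 := (hcl l hl).trans_le (hφβ l hl)
      have p1' := p1.ne'
      have p2' := p2.ne'
      generalize phi b c ν l = p at *
      generalize hq : p + (β - b) * l = q at *
      field_simp
      rw [← hq]; ring)
  intro x hx
  have h1 := hfin x hx
  have h2 : K x = ∫ y in (0 : ℝ)..x, Wβ' (x - y) * W' y := by
    apply intervalIntegral.integral_congr
    intro y hy
    rw [Set.uIcc_of_le hx] at hy
    simp only
    rw [hv' _ (by linarith [hy.2]), hw' _ hy.1]
  simp only [hw' x hx, hv' x hx] at h1
  rw [← h2]
  linarith
end

section
/- As n → ∞ one has ∫₀^∞ ν̄(η_n + y) dy / ν̄(η_n) → ν̄̄(0)/ν̄(0) if ν̄(0) < ∞, and ∫₀^∞ ν̄(η_n + y) dy / ν̄(η_n) → 0 if ν̄(0) = ∞; moreover in both cases (1/n)·∫₀^∞ ν̄(η_n + y) dy → 0. -/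
open MeasureTheory Real Set Filter Topology

theorem aux_fin (ν : Measure ℝ)
    (hνint : ∫⁻ y in Set.Ioi (0 : ℝ), ENNReal.ofReal (min y (y ^ 2)) ∂ν ≠ ⊤)
    (y : ℝ) (hy : 0 < y) : ν (Set.Ici y) ≠ ⊤ := by
  have h1 : ENNReal.ofReal (min y (y ^ 2)) * ν (Set.Ici y)
      ≤ ∫⁻ y in Set.Ioi (0 : ℝ), ENNReal.ofReal (min y (y ^ 2)) ∂ν := by
    rw [← setLIntegral_const]
    refine (setLIntegral_mono' measurableSet_Ici ?_).trans
      (lintegral_mono_set (Set.Ici_subset_Ioi.2 hy))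
    intro x hx
    have hx' : y ≤ x := hx
    exact ENNReal.ofReal_le_ofReal (min_le_min hx' (by gcongr))
  intro h
  have hp : ENNReal.ofReal (min y (y ^ 2)) ≠ 0 := by
    have : 0 < min y (y ^ 2) := lt_min hy (by positivity)
    exact (ENNReal.ofReal_pos.2 this).ne'
  rw [h, ENNReal.mul_top hp] at h1
  exact hνint (top_le_iff.1 h1)

theorem aux_nonneg (ν : Measure ℝ) (y : ℝ) : 0 ≤ tailNu ν y := ENNReal.toReal_nonneg

theorem aux_anti (ν : Measure ℝ)
    (hνint : ∫⁻ y in Set.Ioi (0 : ℝ), ENNReal.ofReal (min y (y ^ 2)) ∂ν ≠ ⊤)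
    (x y : ℝ) (hx : 0 < x) (hxy : x ≤ y) : tailNu ν y ≤ tailNu ν x :=
  ENNReal.toReal_mono (aux_fin ν hνint x hx) (measure_mono (Set.Ici_subset_Ici.2 hxy))

theorem aux_shift_s5 (ν : Measure ℝ) (a : ℝ) :
    ∫ y in Set.Ioi (0 : ℝ), tailNu ν (a + y) = ∫ y in Set.Ioi a, tailNu ν y := by
  have := (measurePreserving_add_left (volume : Measure ℝ) a).setIntegral_preimage_emb
    (measurableEmbedding_addLeft a) (tailNu ν) (Set.Ioi a)
  rw [← this]
  simp

theorem aux_bound (ν : Measure ℝ)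
    (hνint : ∫⁻ y in Set.Ioi (0 : ℝ), ENNReal.ofReal (min y (y ^ 2)) ∂ν ≠ ⊤)
    (a d : ℝ) (ha : 0 < a) (had : a ≤ d) :
    ∫ y in Set.Ioi a, tailNu ν y ≤ d * tailNu ν a + ∫ y in Set.Ioi d, tailNu ν y := by
  have hK : 0 ≤ ∫ y in Set.Ioi d, tailNu ν y := integral_nonneg (fun y => aux_nonneg ν y)
  have hd : 0 ≤ d * tailNu ν a := mul_nonneg (ha.le.trans had) (aux_nonneg ν a)
  by_cases hi : IntegrableOn (tailNu ν) (Set.Ioi a)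
  · rw [← Set.Ioc_union_Ioi_eq_Ioi had, setIntegral_union (Set.Ioc_disjoint_Ioi le_rfl)
      measurableSet_Ioi (hi.mono_set Set.Ioc_subset_Ioi_self)
      (hi.mono_set (Set.Ioi_subset_Ioi had))]
    gcongr
    have h := norm_setIntegral_le_of_norm_le_const (μ := volume) (s := Set.Ioc a d)
      (f := tailNu ν) (C := tailNu ν a) (by simp) (by
        intro x hx
        rw [Real.norm_of_nonneg (aux_nonneg ν x)]
        exact aux_anti ν hνint a x ha hx.1.le)
    refine (le_abs_self _).trans (h.trans ?_)
    rw [Real.volume_real_Ioc_of_le had, mul_comm]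
    exact mul_le_mul_of_nonneg_right (by linarith) (aux_nonneg ν a)
  · rw [integral_undef hi]
    positivity

/-- Proposition 3.4: asymptotics of `∫₀^∞ ν̄(η_n + y) dy / ν̄(η_n)` and `(1/n)∫₀^∞ ν̄(η_n+y) dy`. -/
theorem stmt5
    (b c : ℝ) (hb : 0 ≤ b) (hc : 0 < c)
    (ν : Measure ℝ) (hν0 : ν (Set.Iic 0) = 0)
    (hνint : ∫⁻ y in Set.Ioi (0 : ℝ), ENNReal.ofReal (min y (y ^ 2)) ∂ν ≠ ⊤)
    (η θ : ℕ → ℝ) (hη : ∀ n : ℕ, 0 ≤ η n) (hθ : ∀ n : ℕ, 0 ≤ θ n ∧ θ n < 1)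
    (hseq : (ν (Set.Ici (0 : ℝ)) ≠ ⊤ ∧ (∀ n : ℕ, 1 ≤ n → η n = 0) ∧
        (∀ n : ℕ, 1 ≤ n → θ n = c * tailNu ν 0 / (n : ℝ) ^ 2)) ∨
      (ν (Set.Ici (0 : ℝ)) = ⊤ ∧
        Filter.Tendsto (fun n : ℕ => (n : ℝ) * θ n) Filter.atTop (nhds 0) ∧
        Filter.Tendsto (fun n : ℕ => (n : ℝ) ^ 2 * θ n) Filter.atTop Filter.atTop ∧
        (∀ n : ℕ, 1 ≤ n → tailNu ν (η n) = (n : ℝ) ^ 2 * θ n / c)))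
    :
    (ν (Set.Ici (0 : ℝ)) ≠ ⊤ →
      Filter.Tendsto
        (fun n : ℕ => (∫ y in Set.Ioi (0 : ℝ), tailNu ν (η n + y)) / tailNu ν (η n))
        Filter.atTop (nhds (itailNu ν 0 / tailNu ν 0))) ∧
    (ν (Set.Ici (0 : ℝ)) = ⊤ →
      Filter.Tendsto
        (fun n : ℕ => (∫ y in Set.Ioi (0 : ℝ), tailNu ν (η n + y)) / tailNu ν (η n))
        Filter.atTop (nhds 0)) ∧
    Filter.Tendsto
      (fun n : ℕ => (1 / (n : ℝ)) * ∫ y in Set.Ioi (0 : ℝ), tailNu ν (η n + y))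
      Filter.atTop (nhds 0) := by
  rcases hseq with ⟨hf, hη0, -⟩ | ⟨hf, hnθ, hn2θ, hT⟩
  · refine ⟨fun _ => ?_, fun h => absurd h hf, ?_⟩
    · refine tendsto_const_nhds.congr' ?_
      filter_upwards [eventually_ge_atTop 1] with n hn
      rw [hη0 n hn, aux_shift_s5]
      rfl
    · have h0 : Tendsto (fun n : ℕ => (1 / (n : ℝ)) * ∫ y in Set.Ioi (0 : ℝ), tailNu ν y)
          atTop (nhds 0) := by
        simpa using (tendsto_one_div_atTop_nhds_zero_nat (𝕜 := ℝ)).mul_const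
          (∫ y in Set.Ioi (0 : ℝ), tailNu ν y)
      refine h0.congr' ?_
      filter_upwards [eventually_ge_atTop 1] with n hn
      rw [hη0 n hn, aux_shift_s5]
  · have hTt : Tendsto (fun n : ℕ => tailNu ν (η n)) atTop atTop := by
      refine (hn2θ.atTop_div_const hc).congr' ?_
      filter_upwards [eventually_ge_atTop 1] with n hn
      rw [hT n hn]
    have hpos : ∀ n, 0 < tailNu ν (η n) → 0 < η n := by
      intro n hn
      refine lt_of_le_of_ne (hη n) (fun h => ?_)
      rw [← h] at hn
      simp [tailNu, hf] at hn
    have key : Tendsto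
        (fun n : ℕ => (∫ y in Set.Ioi (0 : ℝ), tailNu ν (η n + y)) / tailNu ν (η n))
        atTop (nhds 0) := by
      refine tendsto_order.2 ⟨fun a ha => ?_, fun e he => ?_⟩
      · exact Eventually.of_forall fun n => lt_of_lt_of_le ha
          (div_nonneg (integral_nonneg (fun y => aux_nonneg ν _)) (aux_nonneg ν _))
      · have he2 : 0 < e / 2 := by positivity
        filter_upwards [hTt.eventually_gt_atTop 0, hTt.eventually_gt_atTop (tailNu ν (e / 2)),
          hTt.eventually_gt_atTop ((∫ y in Set.Ioi (e / 2), tailNu ν y) / (e / 2))]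
          with n h1 h2 h3
        have h4 : η n ≤ e / 2 := by
          by_contra! h
          exact absurd (aux_anti ν hνint _ _ he2 h.le) (not_le.2 h2)
        rw [aux_shift_s5, div_lt_iff₀ h1]
        have h5 := aux_bound ν hνint _ _ (hpos n h1) h4
        rw [div_lt_iff₀ he2] at h3
        linarith
    refine ⟨fun h => absurd hf h, fun _ => key, ?_⟩
    have h0 := key.mul (hnθ.div_const c)
    simp only [zero_div, mul_zero] at h0
    refine h0.congr' ?_
    filter_upwards [hTt.eventually_gt_atTop 0, eventually_ge_atTop 1] with n h1 hn
    have hn0 : (n : ℝ) ≠ 0 := by positivity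
    have h6 : (n : ℝ) * θ n / c = tailNu ν (η n) / n := by
      rw [hT n hn]; field_simp
    rw [h6]
    have := h1.ne'
    field_simp
end
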